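/- For every λ ∈ 𝔫*, the number of irreducible constituents of ξ_λ equals the number of coadjoint G-orbits contained in Ξ_λ, and also equals the number of coadjoint S̄_λ-orbits in the right orbit μ·S̄_λ ⊆ (𝔰̄_λ)*, where μ is the restriction of λ to 𝔰̄_λ. -/

import Mathlib

open scoped Classical BigOperators ComplexOrder

set_option linter.unusedSectionVars false
set_option linter.unusedVariables false

noncomputable section

namespace IterChar

/-! ### Generic notions for finite groups: inner product, induction, characters -/

/-- The standard inner product `⟨f,h⟩_G = |G|⁻¹ ∑_{x ∈ G} f x * conj (h x)`. -/
def innerG (G : Type) [Group G] (f h : G → ℂ) : ℂ :=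
  (Nat.card G : ℂ)⁻¹ * ∑ᶠ x : G, f x * (starRingEnd ℂ) (h x)

/-- Induction of a function from a subgroup, via the Frobenius formula. -/
def indFun {G : Type} [Group G] (H : Subgroup G) (ψ : ↥H → ℂ) : G → ℂ :=
  fun g => (Nat.card ↥H : ℂ)⁻¹ *
    ∑ᶠ x : G, if h : x * g * x⁻¹ ∈ H then ψ ⟨x * g * x⁻¹, h⟩ else 0

/-- A function `G → ℂ` is a character if it is the trace character of some
finite-dimensional complex representation. -/
def IsCharacter (G : Type) [Group G] (f : G → ℂ) : Prop :=
  ∃ V : FDRep ℂ G, f = FDRep.character V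

/-- The set of irreducible characters of `G`: characters of norm one. -/
def Irr (G : Type) [Group G] : Set (G → ℂ) :=
  {f | IsCharacter G f ∧ innerG G f f = 1}

/-- The set of irreducible constituents of `χ`: irreducible characters with
`⟨χ, ψ⟩_G > 0` (using the complex partial order). -/
def IrrConstituents (G : Type) [Group G] (χ : G → ℂ) : Set (G → ℂ) :=
  {f | f ∈ Irr G ∧ 0 < innerG G χ f}

/-! ### Algebra groups -/

variable {F : Type} [Field F] [Fintype F] {R : Type} [Ring R] [Algebra F R] [Fintype R]

/-- `J` is a nilpotent (non-unital) subalgebra: all products of some fixed length vanish. -/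
def IsNil (J : NonUnitalSubalgebra F R) : Prop :=
  ∃ N : ℕ, ∀ l : List R, (∀ x ∈ l, x ∈ J) → l.length = N → l.prod = 0

/-- The algebra group `G = 1 + J` of a (nilpotent) subalgebra `J ⊆ R`, realized as the
subgroup of units `u` of `R` with `u - 1 ∈ J` (and `u⁻¹ - 1 ∈ J`, which is automatic
when `J` is nilpotent). -/
def algGroup (F : Type) [Field F] [Fintype F] (R : Type) [Ring R] [Algebra F R] [Fintype R]
    (J : NonUnitalSubalgebra F R) : Subgroup Rˣ where
  carrier := {u : Rˣ | ((u : R) - 1 ∈ J) ∧ (((u⁻¹ : Rˣ) : R) - 1 ∈ J)}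
  one_mem' := by
    constructor <;> · simp only [Units.val_one, inv_one, sub_self]; exact J.zero_mem
  mul_mem' := by
    rintro u v ⟨hu1, hu2⟩ ⟨hv1, hv2⟩
    constructor
    · have h : ((u * v : Rˣ) : R) - 1 =
          ((u : R) - 1) * ((v : R) - 1) + ((u : R) - 1) + ((v : R) - 1) := by
        push_cast; noncomm_ring
      rw [h]
      exact add_mem (add_mem (mul_mem hu1 hv1) hu1) hv1
    · have h : (((u * v)⁻¹ : Rˣ) : R) - 1 =
          (((v⁻¹ : Rˣ) : R) - 1) * (((u⁻¹ : Rˣ) : R) - 1) +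
            (((v⁻¹ : Rˣ) : R) - 1) + (((u⁻¹ : Rˣ) : R) - 1) := by
        rw [mul_inv_rev]; push_cast; noncomm_ring
      rw [h]
      exact add_mem (add_mem (mul_mem hv2 hu2) hv2) hu2
  inv_mem' := by
    rintro u ⟨h1, h2⟩
    exact ⟨h2, by simpa using h1⟩

theorem mem_algGroup {J : NonUnitalSubalgebra F R} {u : Rˣ} :
    u ∈ algGroup F R J ↔ ((u : R) - 1 ∈ J) ∧ (((u⁻¹ : Rˣ) : R) - 1 ∈ J) :=
  Iff.rfl

/-- The element `X ∈ J` such that `g = 1 + X`. -/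
def gElt {J : NonUnitalSubalgebra F R} (g : ↥(algGroup F R J)) : ↥J :=
  ⟨((g : Rˣ) : R) - 1, g.2.1⟩

/-- The function `θ_λ(1+X) = θ(λ(X))` on the algebra group `1 + J`. -/
def thetaFn (θ : AddChar F ℂ) (J : NonUnitalSubalgebra F R) (lam : ↥J →ₗ[F] F) :
    ↥(algGroup F R J) → ℂ :=
  fun g => θ (lam (gElt g))

/-- Left multiplication by the group element `g` as a linear endomorphism of `J`. -/
def lmulMap {J : NonUnitalSubalgebra F R} (g : ↥(algGroup F R J)) : ↥J →ₗ[F] ↥J where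
  toFun X := ⟨((g : Rˣ) : R) * (X : R), by
    have h : ((g : Rˣ) : R) * (X : R) = (((g : Rˣ) : R) - 1) * (X : R) + (X : R) := by
      noncomm_ring
    rw [h]; exact add_mem (mul_mem g.2.1 X.2) X.2⟩
  map_add' X Y := by ext; simp [mul_add]
  map_smul' c X := by ext; simp [mul_smul_comm]

/-- Right multiplication by the group element `g` as a linear endomorphism of `J`. -/
def rmulMap {J : NonUnitalSubalgebra F R} (g : ↥(algGroup F R J)) : ↥J →ₗ[F] ↥J where
  toFun X := ⟨(X : R) * ((g : Rˣ) : R), by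
    have h : (X : R) * ((g : Rˣ) : R) = (X : R) * (((g : Rˣ) : R) - 1) + (X : R) := by
      noncomm_ring
    rw [h]; exact add_mem (mul_mem X.2 g.2.1) X.2⟩
  map_add' X Y := by ext; simp [add_mul]
  map_smul' c X := by ext; simp [smul_mul_assoc]

/-- The left action of `G` on the dual space: `(gλ)(X) = λ(g⁻¹ X)`. -/
def leftAct {J : NonUnitalSubalgebra F R} (g : ↥(algGroup F R J)) (lam : ↥J →ₗ[F] F) :
    ↥J →ₗ[F] F :=
  lam.comp (lmulMap g⁻¹)

/-- The right action of `G` on the dual space: `(λg)(X) = λ(X g⁻¹)`. -/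
def rightAct {J : NonUnitalSubalgebra F R} (g : ↥(algGroup F R J)) (lam : ↥J →ₗ[F] F) :
    ↥J →ₗ[F] F :=
  lam.comp (rmulMap g⁻¹)

/-- The coadjoint action of `G` on the dual space: `λ^g(X) = λ(g X g⁻¹)`. -/
def coAct {J : NonUnitalSubalgebra F R} (g : ↥(algGroup F R J)) (lam : ↥J →ₗ[F] F) :
    ↥J →ₗ[F] F :=
  lam.comp ((lmulMap g).comp (rmulMap g⁻¹))

/-- The left orbit `Gλ`. -/
def leftOrbit (J : NonUnitalSubalgebra F R) (lam : ↥J →ₗ[F] F) : Set (↥J →ₗ[F] F) :=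
  Set.range fun g : ↥(algGroup F R J) => leftAct g lam

/-- The right orbit `λG`. -/
def rightOrbit (J : NonUnitalSubalgebra F R) (lam : ↥J →ₗ[F] F) : Set (↥J →ₗ[F] F) :=
  Set.range fun g : ↥(algGroup F R J) => rightAct g lam

/-- The two-sided orbit `GλG`. -/
def twoOrbit (J : NonUnitalSubalgebra F R) (lam : ↥J →ₗ[F] F) : Set (↥J →ₗ[F] F) :=
  {mu | ∃ g h : ↥(algGroup F R J), mu = leftAct g (rightAct h lam)}

/-- The coadjoint orbit `λ^G`. -/
def coOrbit (J : NonUnitalSubalgebra F R) (lam : ↥J →ₗ[F] F) : Set (↥J →ₗ[F] F) :=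
  Set.range fun g : ↥(algGroup F R J) => coAct g lam

/-- The right orbit of `λ` under a subgroup `H` of the algebra group. -/
def rightOrbitUnder (J : NonUnitalSubalgebra F R) (H : Subgroup ↥(algGroup F R J))
    (lam : ↥J →ₗ[F] F) : Set (↥J →ₗ[F] F) :=
  {mu | ∃ s ∈ H, mu = rightAct s lam}

/-- The Kirillov function `ψ_λ = |λ^G|^{-1/2} ∑_{μ ∈ λ^G} θ_μ`. -/
def kirillov (θ : AddChar F ℂ) (J : NonUnitalSubalgebra F R) (lam : ↥J →ₗ[F] F) :
    ↥(algGroup F R J) → ℂ :=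
  fun g => ((Real.sqrt (Nat.card ↥(coOrbit J lam)) : ℂ))⁻¹ *
    ∑ᶠ mu ∈ coOrbit J lam, thetaFn θ J mu g

/-- The supercharacter `χ_λ = (|Gλ|/|GλG|) ∑_{μ ∈ GλG} θ_μ`. -/
def superchar (θ : AddChar F ℂ) (J : NonUnitalSubalgebra F R) (lam : ↥J →ₗ[F] F) :
    ↥(algGroup F R J) → ℂ :=
  fun g => ((Nat.card ↥(leftOrbit J lam) : ℂ) / (Nat.card ↥(twoOrbit J lam) : ℂ)) *
    ∑ᶠ mu ∈ twoOrbit J lam, thetaFn θ J mu g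

/-! ### The subalgebras `𝔩_λ`, `𝔰_λ` and their iterates -/

/-- The extension of `λ : J → F` by zero to all of `R`. -/
def lamE (J : NonUnitalSubalgebra F R) (lam : ↥J →ₗ[F] F) (x : R) : F :=
  if h : x ∈ J then lam ⟨x, h⟩ else 0

theorem lamE_apply (J : NonUnitalSubalgebra F R) (lam : ↥J →ₗ[F] F) {x : R} (hx : x ∈ J) :
    lamE J lam x = lam ⟨x, hx⟩ := dif_pos hx

theorem lamE_zero (J : NonUnitalSubalgebra F R) (lam : ↥J →ₗ[F] F) : lamE J lam 0 = 0 := by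
  rw [lamE_apply J lam J.zero_mem]
  have h : (⟨(0 : R), J.zero_mem⟩ : ↥J) = 0 := Subtype.ext rfl
  rw [h, map_zero]

theorem lamE_add (J : NonUnitalSubalgebra F R) (lam : ↥J →ₗ[F] F) {x y : R}
    (hx : x ∈ J) (hy : y ∈ J) : lamE J lam (x + y) = lamE J lam x + lamE J lam y := by
  rw [lamE, lamE, lamE, dif_pos (add_mem hx hy), dif_pos hx, dif_pos hy]
  have h : (⟨x + y, add_mem hx hy⟩ : ↥J) = ⟨x, hx⟩ + ⟨y, hy⟩ := Subtype.ext rfl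
  rw [h, map_add]

theorem lamE_smul (J : NonUnitalSubalgebra F R) (lam : ↥J →ₗ[F] F) (c : F) {x : R}
    (hx : x ∈ J) : lamE J lam (c • x) = c * lamE J lam x := by
  rw [lamE, lamE, dif_pos (SMulMemClass.smul_mem c hx), dif_pos hx]
  have h : (⟨c • x, SMulMemClass.smul_mem c hx⟩ : ↥J) = c • ⟨x, hx⟩ := Subtype.ext rfl
  rw [h, map_smul]
  rfl

/-- The left kernel `𝔩` of the bilinear form `(X,Y) ↦ λ(XY)` restricted to `s × s`. -/
def lStep (J : NonUnitalSubalgebra F R) (lam : ↥J →ₗ[F] F)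
    (s : NonUnitalSubalgebra F R) (hs : s ≤ J) : NonUnitalSubalgebra F R where
  carrier := {x | x ∈ s ∧ ∀ y ∈ s, lamE J lam (x * y) = 0}
  zero_mem' := ⟨zero_mem s, fun y _ => by rw [zero_mul, lamE_zero]⟩
  add_mem' := by
    rintro a b ⟨ha1, ha2⟩ ⟨hb1, hb2⟩
    refine ⟨add_mem ha1 hb1, fun y hy => ?_⟩
    rw [add_mul, lamE_add J lam (J.mul_mem (hs ha1) (hs hy)) (J.mul_mem (hs hb1) (hs hy)),
      ha2 y hy, hb2 y hy, add_zero]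
  smul_mem' := by
    rintro c a ⟨ha1, ha2⟩
    refine ⟨SMulMemClass.smul_mem c ha1, fun y hy => ?_⟩
    rw [smul_mul_assoc, lamE_smul J lam c (J.mul_mem (hs ha1) (hs hy)), ha2 y hy, mul_zero]
  mul_mem' := by
    rintro a b ⟨ha1, ha2⟩ ⟨hb1, hb2⟩
    refine ⟨mul_mem ha1 hb1, fun y hy => ?_⟩
    rw [mul_assoc]
    exact ha2 (b * y) (mul_mem hb1 hy)

theorem lStep_le (J : NonUnitalSubalgebra F R) (lam : ↥J →ₗ[F] F)
    (s : NonUnitalSubalgebra F R) (hs : s ≤ J) : lStep J lam s hs ≤ s :=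
  fun _ hx => hx.1

/-- The left kernel `𝔰` of the bilinear form `(X,Y) ↦ λ(XY)` restricted to `s × 𝔩`. -/
def sStep (J : NonUnitalSubalgebra F R) (lam : ↥J →ₗ[F] F)
    (s : NonUnitalSubalgebra F R) (hs : s ≤ J) : NonUnitalSubalgebra F R where
  carrier := {x | x ∈ s ∧ ∀ y ∈ lStep J lam s hs, lamE J lam (x * y) = 0}
  zero_mem' := ⟨zero_mem s, fun y _ => by rw [zero_mul, lamE_zero]⟩
  add_mem' := by
    rintro a b ⟨ha1, ha2⟩ ⟨hb1, hb2⟩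
    refine ⟨add_mem ha1 hb1, fun y hy => ?_⟩
    rw [add_mul, lamE_add J lam (J.mul_mem (hs ha1) (hs hy.1)) (J.mul_mem (hs hb1) (hs hy.1)),
      ha2 y hy, hb2 y hy, add_zero]
  smul_mem' := by
    rintro c a ⟨ha1, ha2⟩
    refine ⟨SMulMemClass.smul_mem c ha1, fun y hy => ?_⟩
    rw [smul_mul_assoc, lamE_smul J lam c (J.mul_mem (hs ha1) (hs hy.1)), ha2 y hy, mul_zero]
  mul_mem' := by
    rintro a b ⟨ha1, ha2⟩ ⟨hb1, hb2⟩
    refine ⟨mul_mem ha1 hb1, fun y hy => ?_⟩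
    rw [mul_assoc]
    refine ha2 (b * y) ⟨mul_mem hb1 hy.1, fun z hz => ?_⟩
    rw [mul_assoc]
    refine hb2 (y * z) ⟨mul_mem hy.1 hz, fun w hw => ?_⟩
    rw [mul_assoc]
    exact hy.2 (z * w) (mul_mem hz hw)

theorem sStep_le (J : NonUnitalSubalgebra F R) (lam : ↥J →ₗ[F] F)
    (s : NonUnitalSubalgebra F R) (hs : s ≤ J) : sStep J lam s hs ≤ s :=
  fun _ hx => hx.1

/-- `𝔩_λ`: the left kernel of `(X,Y) ↦ λ(XY)` on `J × J`. -/
def lone (J : NonUnitalSubalgebra F R) (lam : ↥J →ₗ[F] F) : NonUnitalSubalgebra F R :=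
  lStep J lam J le_rfl

/-- `𝔰_λ`: the left kernel of `(X,Y) ↦ λ(XY)` on `J × 𝔩_λ`. -/
def sone (J : NonUnitalSubalgebra F R) (lam : ↥J →ₗ[F] F) : NonUnitalSubalgebra F R :=
  sStep J lam J le_rfl

theorem lone_le (J : NonUnitalSubalgebra F R) (lam : ↥J →ₗ[F] F) : lone J lam ≤ J :=
  lStep_le J lam J le_rfl

theorem sone_le (J : NonUnitalSubalgebra F R) (lam : ↥J →ₗ[F] F) : sone J lam ≤ J :=
  sStep_le J lam J le_rfl

/-- `𝔨_λ = 𝔩_λ ∩ ker λ`. -/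
def kone (J : NonUnitalSubalgebra F R) (lam : ↥J →ₗ[F] F) : NonUnitalSubalgebra F R where
  carrier := {x | x ∈ lone J lam ∧ lamE J lam x = 0}
  zero_mem' := ⟨zero_mem _, lamE_zero J lam⟩
  add_mem' := by
    rintro a b ⟨ha1, ha2⟩ ⟨hb1, hb2⟩
    exact ⟨add_mem ha1 hb1, by
      rw [lamE_add J lam (lone_le J lam ha1) (lone_le J lam hb1), ha2, hb2, add_zero]⟩
  smul_mem' := by
    rintro c a ⟨ha1, ha2⟩
    exact ⟨SMulMemClass.smul_mem c ha1, by
      rw [lamE_smul J lam c (lone_le J lam ha1), ha2, mul_zero]⟩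
  mul_mem' := by
    rintro a b ⟨ha1, ha2⟩ ⟨hb1, hb2⟩
    exact ⟨mul_mem ha1 hb1, ha1.2 b (lone_le J lam hb1)⟩

theorem kone_le (J : NonUnitalSubalgebra F R) (lam : ↥J →ₗ[F] F) : kone J lam ≤ lone J lam :=
  fun _ hx => hx.1

/-- The descending chain `𝔰_λ^0 ⊇ 𝔰_λ^1 ⊇ ⋯` (bundled with the proof `𝔰_λ^i ≤ J`). -/
def sChainAux (J : NonUnitalSubalgebra F R) (lam : ↥J →ₗ[F] F) :
    ℕ → {s : NonUnitalSubalgebra F R // s ≤ J}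
  | 0 => ⟨J, le_rfl⟩
  | n + 1 =>
    ⟨sStep J lam (sChainAux J lam n).1 (sChainAux J lam n).2,
      le_trans (sStep_le J lam (sChainAux J lam n).1 (sChainAux J lam n).2)
        (sChainAux J lam n).2⟩

/-- `𝔰_λ^i`. -/
def sChain (J : NonUnitalSubalgebra F R) (lam : ↥J →ₗ[F] F) (i : ℕ) :
    NonUnitalSubalgebra F R :=
  (sChainAux J lam i).1

/-- `𝔩_λ^{i+1}`. -/
def lChain (J : NonUnitalSubalgebra F R) (lam : ↥J →ₗ[F] F) (i : ℕ) :
    NonUnitalSubalgebra F R :=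
  lStep J lam (sChainAux J lam i).1 (sChainAux J lam i).2

/-- The terminal element `𝔰̄_λ` of the descending chain; the chain has stabilized by
stage `|R|` since it is a weakly decreasing chain of subalgebras of the finite algebra. -/
def sbar (J : NonUnitalSubalgebra F R) (lam : ↥J →ₗ[F] F) : NonUnitalSubalgebra F R :=
  sChain J lam (Fintype.card R)

theorem sbar_le (J : NonUnitalSubalgebra F R) (lam : ↥J →ₗ[F] F) : sbar J lam ≤ J :=
  (sChainAux J lam (Fintype.card R)).2

/-- The terminal element `𝔩̄_λ` of the ascending chain. -/
def lbar (J : NonUnitalSubalgebra F R) (lam : ↥J →ₗ[F] F) : NonUnitalSubalgebra F R :=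
  lStep J lam (sbar J lam) (sbar_le J lam)

theorem lbar_le (J : NonUnitalSubalgebra F R) (lam : ↥J →ₗ[F] F) : lbar J lam ≤ J :=
  le_trans (lStep_le J lam _ _) (sbar_le J lam)

/-! ### Algebra subgroups of an algebra group -/

/-- The algebra subgroup `1 + k` of `1 + J`, as a subgroup of the ambient algebra group. -/
def algSubgroup (k J : NonUnitalSubalgebra F R) : Subgroup ↥(algGroup F R J) :=
  (algGroup F R k).subgroupOf (algGroup F R J)

/-- `L_λ = 1 + 𝔩_λ` as a subgroup of `G`. -/
def Lgrp (J : NonUnitalSubalgebra F R) (lam : ↥J →ₗ[F] F) : Subgroup ↥(algGroup F R J) :=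
  algSubgroup (lone J lam) J

/-- `S_λ = 1 + 𝔰_λ` as a subgroup of `G`. -/
def Sgrp (J : NonUnitalSubalgebra F R) (lam : ↥J →ₗ[F] F) : Subgroup ↥(algGroup F R J) :=
  algSubgroup (sone J lam) J

/-- `L̄_λ = 1 + 𝔩̄_λ` as a subgroup of `G`. -/
def Lbarg (J : NonUnitalSubalgebra F R) (lam : ↥J →ₗ[F] F) : Subgroup ↥(algGroup F R J) :=
  algSubgroup (lbar J lam) J

/-- `S̄_λ = 1 + 𝔰̄_λ` as a subgroup of `G`. -/
def Sbarg (J : NonUnitalSubalgebra F R) (lam : ↥J →ₗ[F] F) : Subgroup ↥(algGroup F R J) :=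
  algSubgroup (sbar J lam) J

/-- Passing from an element of the subgroup `1 + k ≤ 1 + J` to an element of the
algebra group `1 + k` in its own right. -/
def toAlg {k J : NonUnitalSubalgebra F R} (x : ↥(algSubgroup k J)) : ↥(algGroup F R k) :=
  ⟨((x : ↥(algGroup F R J)) : Rˣ), Subgroup.mem_subgroupOf.mp x.2⟩

/-- The linear inclusion of a smaller subalgebra. -/
def inclMap {s J : NonUnitalSubalgebra F R} (h : s ≤ J) : ↥s →ₗ[F] ↥J where
  toFun x := ⟨(x : R), h x.2⟩
  map_add' x y := rfl
  map_smul' c x := rfl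

/-- Restriction of a functional on `J` to a smaller subalgebra. -/
def resTo {s J : NonUnitalSubalgebra F R} (h : s ≤ J) (lam : ↥J →ₗ[F] F) : ↥s →ₗ[F] F :=
  lam.comp (inclMap h)

/-- The character `ξ_λ = Ind_{L̄_λ}^G (θ_λ)`. -/
def xi (θ : AddChar F ℂ) (J : NonUnitalSubalgebra F R) (lam : ↥J →ₗ[F] F) :
    ↥(algGroup F R J) → ℂ :=
  indFun (Lbarg J lam) (fun x => thetaFn θ J lam ↑x)

/-- The set `Ξ_λ = {g λ s g⁻¹ : g ∈ G, s ∈ S̄_λ}`. -/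
def Xi (J : NonUnitalSubalgebra F R) (lam : ↥J →ₗ[F] F) : Set (↥J →ₗ[F] F) :=
  {nu | ∃ g : ↥(algGroup F R J), ∃ s ∈ Sbarg J lam, nu = coAct g (rightAct s lam)}

/-! ### Normality of algebra subgroups coming from ideals -/

theorem conj_mem_aux (s a : NonUnitalSubalgebra F R)
    (hl : ∀ x ∈ s, ∀ y ∈ a, x * y ∈ a) (hr : ∀ y ∈ a, ∀ x ∈ s, y * x ∈ a)
    (u : Rˣ) (hu1 : (u : R) - 1 ∈ s) (hu2 : ((u⁻¹ : Rˣ) : R) - 1 ∈ s)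
    (x : Rˣ) (hx : (x : R) - 1 ∈ a) : ((u * x * u⁻¹ : Rˣ) : R) - 1 ∈ a := by
  have h1 : (u : R) * ((u⁻¹ : Rˣ) : R) = 1 := Units.mul_inv u
  have key : ((u * x * u⁻¹ : Rˣ) : R) - 1 =
      ((u : R) - 1) * ((x : R) - 1) * (((u⁻¹ : Rˣ) : R) - 1) +
        ((u : R) - 1) * ((x : R) - 1) + ((x : R) - 1) * (((u⁻¹ : Rˣ) : R) - 1) +
        ((x : R) - 1) := by
    push_cast
    calc (u : R) * (x : R) * ((u⁻¹ : Rˣ) : R) - 1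
        = (u : R) * (x : R) * ((u⁻¹ : Rˣ) : R) - (u : R) * ((u⁻¹ : Rˣ) : R) := by rw [h1]
      _ = _ := by noncomm_ring
  rw [key]
  exact add_mem (add_mem (add_mem (hr _ (hl _ hu1 _ hx) _ hu2) (hl _ hu1 _ hx))
    (hr _ hx _ hu2)) hx

theorem algSubgroup_normal (s a : NonUnitalSubalgebra F R)
    (hl : ∀ x ∈ s, ∀ y ∈ a, x * y ∈ a) (hr : ∀ y ∈ a, ∀ x ∈ s, y * x ∈ a) :
    ((algGroup F R a).subgroupOf (algGroup F R s)).Normal := by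
  constructor
  intro n hn g
  rw [Subgroup.mem_subgroupOf] at hn ⊢
  have hginv : ((g⁻¹ : ↥(algGroup F R s)) : Rˣ) = ((g : Rˣ))⁻¹ := rfl
  have hcoe : ((g * n * g⁻¹ : ↥(algGroup F R s)) : Rˣ) = (g : Rˣ) * (n : Rˣ) * ((g : Rˣ))⁻¹ := by
    push_cast [hginv]; rfl
  rw [mem_algGroup]
  constructor
  · rw [hcoe]
    exact conj_mem_aux s a hl hr (g : Rˣ) (g : ↥(algGroup F R s)).2.1 (g : ↥(algGroup F R s)).2.2
      (n : Rˣ) hn.1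
  · have hinv : (((g * n * g⁻¹ : ↥(algGroup F R s)) : Rˣ))⁻¹ =
        (g : Rˣ) * ((n : Rˣ))⁻¹ * ((g : Rˣ))⁻¹ := by
      rw [hcoe]; group
    rw [hinv]
    exact conj_mem_aux s a hl hr (g : Rˣ) (g : ↥(algGroup F R s)).2.1 (g : ↥(algGroup F R s)).2.2
      ((n : Rˣ))⁻¹ hn.2

theorem lone_mul_mem (J : NonUnitalSubalgebra F R) (lam : ↥J →ₗ[F] F)
    {y z : R} (hy : y ∈ lone J lam) (hz : z ∈ J) : y * z ∈ lone J lam := by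
  refine ⟨J.mul_mem (lone_le J lam hy) hz, fun w hw => ?_⟩
  rw [mul_assoc]
  exact hy.2 (z * w) (J.mul_mem hz hw)

theorem sone_mul_lone_mem (J : NonUnitalSubalgebra F R) (lam : ↥J →ₗ[F] F)
    {x y : R} (hx : x ∈ sone J lam) (hy : y ∈ lone J lam) : x * y ∈ lone J lam := by
  refine ⟨J.mul_mem (sone_le J lam hx) (lone_le J lam hy), fun w hw => ?_⟩
  rw [mul_assoc]
  exact hx.2 (y * w) (lone_mul_mem J lam hy hw)

theorem kone_ideal_left (J : NonUnitalSubalgebra F R) (lam : ↥J →ₗ[F] F) :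
    ∀ x ∈ sone J lam, ∀ y ∈ kone J lam, x * y ∈ kone J lam := by
  intro x hx y hy
  exact ⟨sone_mul_lone_mem J lam hx hy.1, hx.2 y hy.1⟩

theorem kone_ideal_right (J : NonUnitalSubalgebra F R) (lam : ↥J →ₗ[F] F) :
    ∀ y ∈ kone J lam, ∀ x ∈ sone J lam, y * x ∈ kone J lam := by
  intro y hy x hx
  exact ⟨lone_mul_mem J lam hy.1 (sone_le J lam hx), hy.1.2 x (sone_le J lam hx)⟩

/-- `K_λ = 1 + 𝔨_λ` as a (normal) subgroup of `S_λ = 1 + 𝔰_λ`. -/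
def KgrpIn (J : NonUnitalSubalgebra F R) (lam : ↥J →ₗ[F] F) :
    Subgroup ↥(algGroup F R (sone J lam)) :=
  (algGroup F R (kone J lam)).subgroupOf (algGroup F R (sone J lam))

instance KgrpIn_normal (J : NonUnitalSubalgebra F R) (lam : ↥J →ₗ[F] F) :
    (KgrpIn J lam).Normal :=
  algSubgroup_normal (sone J lam) (kone J lam) (kone_ideal_left J lam) (kone_ideal_right J lam)

/-- `L_λ = 1 + 𝔩_λ` as a (normal) subgroup of `S_λ = 1 + 𝔰_λ`. -/
def LgrpIn (J : NonUnitalSubalgebra F R) (lam : ↥J →ₗ[F] F) :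
    Subgroup ↥(algGroup F R (sone J lam)) :=
  (algGroup F R (lone J lam)).subgroupOf (algGroup F R (sone J lam))

instance LgrpIn_normal (J : NonUnitalSubalgebra F R) (lam : ↥J →ₗ[F] F) :
    (LgrpIn J lam).Normal :=
  algSubgroup_normal (sone J lam) (lone J lam)
    (fun x hx y hy => sone_mul_lone_mem J lam hx hy)
    (fun y hy x hx => lone_mul_mem J lam hy (sone_le J lam hx))

/-! ### Characters of finite groups -/

section Characters

variable {G : Type} [Group G] [Fintype G]

theorem character_inv {V : Type*} [AddCommGroup V] [Module ℂ V] [FiniteDimensional ℂ V]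
    (ρ : Representation ℂ G V) (g : G) :
    ρ.character g⁻¹ = (starRingEnd ℂ) (ρ.character g) := by
  let b := Module.finBasis ℂ V
  let A : G → Matrix (Fin (Module.finrank ℂ V)) (Fin (Module.finrank ℂ V)) ℂ :=
    fun g => LinearMap.toMatrix b b (ρ g)
  have hmul : ∀ g h, A (g * h) = A g * A h := fun g h => by
    simp only [A, map_mul, ← LinearMap.toMatrix_mul]
  have hone : A 1 = 1 := by simp [A]
  have htr : ∀ g, ρ.character g = (A g).trace := fun g =>
    LinearMap.trace_eq_matrix_trace ℂ b (ρ g)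
  let H := ∑ x : G, (A x).conjTranspose * A x
  have hH : H.PosDef := by
    have : H = (1 : Matrix _ _ ℂ) +
        ∑ x ∈ Finset.univ.erase (1 : G), (A x).conjTranspose * A x := by
      simp only [H]
      rw [← Finset.add_sum_erase _ _ (Finset.mem_univ (1 : G)), hone]
      simp
    rw [this]
    refine Matrix.PosDef.one.add_posSemidef ?_
    exact Matrix.posSemidef_sum _ fun x _ => Matrix.posSemidef_conjTranspose_mul_self _
  have hinv : (A g).conjTranspose * H * A g = H := by
    simp only [H, Finset.mul_sum, Finset.sum_mul]
    refine Fintype.sum_equiv (Equiv.mulRight g) _ _ fun x => ?_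
    simp only [Equiv.coe_mulRight, hmul, Matrix.conjTranspose_mul, Matrix.mul_assoc]
  have hdet : IsUnit H.det := (Matrix.isUnit_iff_isUnit_det H).1 hH.isUnit
  have h1 : (A g).conjTranspose * H = H * A g⁻¹ := by
    have h2 : A g * A g⁻¹ = 1 := by rw [← hmul, mul_inv_cancel, hone]
    calc (A g).conjTranspose * H = (A g).conjTranspose * H * (A g * A g⁻¹) := by
          rw [h2, Matrix.mul_one]
      _ = ((A g).conjTranspose * H * A g) * A g⁻¹ := by simp only [Matrix.mul_assoc]
      _ = H * A g⁻¹ := by rw [hinv]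
  have h3 : A g⁻¹ = H⁻¹ * ((A g).conjTranspose * H) := by
    rw [h1, ← Matrix.mul_assoc, Matrix.nonsing_inv_mul _ hdet, Matrix.one_mul]
  rw [htr, htr, h3, Matrix.trace_mul_comm, Matrix.mul_assoc, Matrix.mul_nonsing_inv _ hdet,
    Matrix.mul_one, Matrix.trace_conjTranspose]
  rfl

theorem innerG_eq_sum (f h : G → ℂ) :
    innerG G f h = (Nat.card G : ℂ)⁻¹ * ∑ x : G, f x * (starRingEnd ℂ) (h x) := by
  rw [innerG, finsum_eq_sum_of_fintype]

theorem innerG_character (V W : FDRep ℂ G) :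
    innerG G V.character W.character =
      (Nat.card G : ℂ)⁻¹ * ∑ x : G, V.character x * W.character x⁻¹ := by
  rw [innerG_eq_sum]
  congr 1
  refine Finset.sum_congr rfl fun x _ => ?_
  congr 1
  exact (character_inv W.ρ x).symm

theorem card_ne_zero' : (Nat.card G : ℂ) ≠ 0 := Nat.cast_ne_zero.2 Nat.card_pos.ne'

theorem simple_of_norm_one (V : FDRep ℂ G) (hV : innerG G V.character V.character = 1) :
    CategoryTheory.Simple V := by
  rw [FDRep.simple_iff_char_is_norm_one]
  rw [innerG_character, inv_mul_eq_one₀ card_ne_zero'] at hV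
  exact hV.symm

theorem innerG_irr_eq_zero {f h : G → ℂ} (hf : f ∈ Irr G) (hh : h ∈ Irr G) (hne : f ≠ h) :
    innerG G f h = 0 := by
  obtain ⟨⟨V, rfl⟩, hV⟩ := hf
  obtain ⟨⟨W, rfl⟩, hW⟩ := hh
  have := simple_of_norm_one V hV
  have := simple_of_norm_one W hW
  have : Invertible (Nat.card G : ℂ) := invertibleOfNonzero card_ne_zero'
  rw [innerG_character, FDRep.char_orthonormal, if_neg]
  rintro ⟨i⟩
  exact hne (FDRep.char_iso i)

theorem character_mem_irr {V : Type} [AddCommGroup V] [Module ℂ V] [FiniteDimensional ℂ V]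
    (ρ : Representation ℂ G V) [ρ.IsIrreducible] : ρ.character ∈ Irr G := by
  have : Invertible (Nat.card G : ℂ) := invertibleOfNonzero card_ne_zero'
  refine ⟨⟨FDRep.of ρ, rfl⟩, ?_⟩
  have h := Representation.char_orthonormal ρ ρ
  rw [if_pos ⟨Representation.Equiv.refl ρ⟩] at h
  have h2 := innerG_character (FDRep.of ρ) (FDRep.of ρ)
  exact h2.trans h

/-- Evaluation of a function on `G` against an element of the group algebra. -/
theorem trace_asAlgebraHom {V : Type*} [AddCommGroup V] [Module ℂ V] [FiniteDimensional ℂ V]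
    (ρ : Representation ℂ G V) (a : MonoidAlgebra ℂ G) :
    LinearMap.trace ℂ V (ρ.asAlgebraHom a) = ∑ g : G, a.coeff g * ρ.character g := by
  rw [Representation.asAlgebraHom_def, MonoidAlgebra.lift_apply, Finsupp.sum_fintype _ _ (by simp)]
  simp [map_sum, Representation.character]

theorem asAlgebraHom_center {V : Type*} [AddCommGroup V] [Module ℂ V] [FiniteDimensional ℂ V]
    (ρ : Representation ℂ G V)
    (hρ : (Nat.card G : ℂ)⁻¹ * ∑ g : G, ρ.character g * ρ.character g⁻¹ = 1)
    {z : MonoidAlgebra ℂ G} (hz : z ∈ Subalgebra.center ℂ (MonoidAlgebra ℂ G)) :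
    ∃ c : ℂ, ρ.asAlgebraHom z = c • 1 := by
  have : Invertible (Nat.card G : ℂ) := invertibleOfNonzero card_ne_zero'
  rw [Representation.card_inv_mul_sum_char_mul_char_eq_finrank, Nat.cast_eq_one] at hρ
  have hne : (Representation.IntertwiningMap.id ρ) ≠ 0 := by
    intro h0
    have : ∀ f : Representation.IntertwiningMap ρ ρ, f = 0 := by
      intro f
      ext v
      have : v = 0 := by
        have := congrArg (fun f : Representation.IntertwiningMap ρ ρ => f v) h0
        simpa using this
      simp [this]
    have : Subsingleton (Representation.IntertwiningMap ρ ρ) :=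
      ⟨fun a b => (this a).trans (this b).symm⟩
    rw [Module.finrank_zero_of_subsingleton] at hρ
    omega
  obtain ⟨c, hc⟩ := (finrank_eq_one_iff_of_nonzero' _ hne).1 hρ
    (Representation.IntertwiningMap.centralAlgebraMul ρ (z := z) hz)
  refine ⟨c, ?_⟩
  ext v
  have := congrArg (fun f : Representation.IntertwiningMap ρ ρ => f v) hc
  exact this.symm

theorem smul_eq_zero_of_forall_irreducible (M : Type) [AddCommGroup M] [Module (MonoidAlgebra ℂ G) M]
   [Module.Finite (MonoidAlgebra ℂ G) M]
    [IsSimpleModule (MonoidAlgebra ℂ G) M] (a : MonoidAlgebra ℂ G) 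
    (h : ∀ (V : Type) [AddCommGroup V] [Module ℂ V] [FiniteDimensional ℂ V]
      (ρ : Representation ℂ G V) [ρ.IsIrreducible], ρ.asAlgebraHom a = 0) (y : M) : a • y = 0 := by
  have h0 := (Representation.isSimpleModule_iff_irreducible_ofModule (k := ℂ) (G := G) M).1 inferInstance
  have h5 := @Module.Finite.trans ℂ (MonoidAlgebra ℂ G) (RestrictScalars ℂ (MonoidAlgebra ℂ G) M) _ _ _ _ (RestrictScalars.module ℂ (MonoidAlgebra ℂ G) M)
    (RestrictScalars.moduleOrig ℂ (MonoidAlgebra ℂ G) M) (RestrictScalars.isScalarTower ℂ (MonoidAlgebra ℂ G) M) inferInstance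
    ‹Module.Finite (MonoidAlgebra ℂ G) M›
  have h1 : (Representation.ofModule (k := ℂ) (G := G) M).asAlgebraHom a = 0 := @h (RestrictScalars ℂ (MonoidAlgebra ℂ G) M) (inferInstanceAs (AddCommGroup M))
    (RestrictScalars.module ℂ (MonoidAlgebra ℂ G) M) h5 (Representation.ofModule (k := ℂ) (G := G) M) h0
  have h2 := Representation.ofModule_asAlgebraHom_apply_apply (k := ℂ) (G := G) (M := M) a
        ((RestrictScalars.addEquiv ℂ (MonoidAlgebra ℂ G) M).symm y)
  rw [h1] at h2
  have h3 := congrArg (RestrictScalars.addEquiv ℂ (MonoidAlgebra ℂ G) M) h2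
  simpa using h3.symm

theorem eq_zero_of_forall_irreducible (a : MonoidAlgebra ℂ G)
    (h : ∀ (V : Type) [AddCommGroup V] [Module ℂ V] [FiniteDimensional ℂ V]
      (ρ : Representation ℂ G V) [ρ.IsIrreducible], ρ.asAlgebraHom a = 0) : a = 0 := by
  have : NeZero (Nat.card G : ℂ) := ⟨card_ne_zero'⟩
  have key : ∀ x : MonoidAlgebra ℂ G, a • x = 0 := by
    intro x
    have hx : x ∈ sSup {m : Submodule (MonoidAlgebra ℂ G) (MonoidAlgebra ℂ G) |
        IsSimpleModule (MonoidAlgebra ℂ G) m} := by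
      rw [IsSemisimpleModule.sSup_simples_eq_top]; trivial
    rw [sSup_eq_iSup'] at hx
    refine Submodule.iSup_induction _ (motive := fun x => a • x = 0) hx ?_ (by simp) ?_
    · rintro ⟨m, hm⟩ y hy
      have : IsSimpleModule (MonoidAlgebra ℂ G) m := hm
      simpa [Subtype.ext_iff] using smul_eq_zero_of_forall_irreducible m a h ⟨y, hy⟩
    · intro x y hx hy
      rw [smul_add, hx, hy, add_zero]
  simpa using key 1

end Characters

/-! ### Frobenius reciprocity and the idempotent of a linear character -/

section Idempotent

variable {G : Type} [Group G] [Fintype G] (L : Subgroup G) (ϑ : ↥L →* ℂ)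

theorem conj_linear (x : ↥L) : (starRingEnd ℂ) (ϑ x) = ϑ x⁻¹ := by
  have h1 : ϑ x ^ Fintype.card ↥L = 1 := by rw [← map_pow, pow_card_eq_one, map_one]
  have h2 : ‖ϑ x‖ = 1 := Complex.norm_eq_one_of_pow_eq_one h1 Fintype.card_ne_zero
  rw [← Complex.inv_eq_conj h2]
  refine inv_eq_of_mul_eq_one_right ?_
  rw [← map_mul, mul_inv_cancel, map_one]

/-- The idempotent of the group algebra attached to a linear character of a subgroup. -/
def idem : MonoidAlgebra ℂ G :=
  (Nat.card ↥L : ℂ)⁻¹ • ∑ x : ↥L, MonoidAlgebra.single (x : G) (ϑ x⁻¹)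

theorem single_mul_idem (y : ↥L) :
    MonoidAlgebra.single (y : G) 1 * idem L ϑ = ϑ y • idem L ϑ := by
  rw [idem, mul_smul_comm, smul_comm (ϑ y), Finset.mul_sum]
  congr 1
  rw [Finset.smul_sum]
  refine Fintype.sum_equiv (Equiv.mulLeft y) _ _ fun x => ?_
  rw [MonoidAlgebra.single_mul_single, MonoidAlgebra.smul_single, one_mul, smul_eq_mul, ← map_mul]
  rw [show y * (Equiv.mulLeft y x)⁻¹ = y * x⁻¹ * y⁻¹ by simp [mul_assoc], map_mul, map_mul,
    mul_right_comm, ← map_mul, mul_inv_cancel, map_one, one_mul]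
  rfl

theorem idem_mul_single (y : ↥L) :
    idem L ϑ * MonoidAlgebra.single (y : G) 1 = ϑ y • idem L ϑ := by
  rw [idem, smul_mul_assoc, smul_comm (ϑ y), Finset.sum_mul]
  congr 1
  rw [Finset.smul_sum]
  refine Fintype.sum_equiv (Equiv.mulRight y) _ _ fun x => ?_
  rw [MonoidAlgebra.single_mul_single, MonoidAlgebra.smul_single, mul_one, smul_eq_mul, ← map_mul]
  simp

theorem single_eq_smul (g : G) (c : ℂ) :
    MonoidAlgebra.single g c = c • MonoidAlgebra.single g (1 : ℂ) := by
  rw [MonoidAlgebra.smul_single, smul_eq_mul, mul_one]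

theorem idem_mul_idem : idem L ϑ * idem L ϑ = idem L ϑ := by
  conv_lhs => enter [1]; rw [idem]
  rw [smul_mul_assoc, Finset.sum_mul]
  have : ∀ x : ↥L, MonoidAlgebra.single (x : G) (ϑ x⁻¹) * idem L ϑ = idem L ϑ := by
    intro x
    rw [single_eq_smul, smul_mul_assoc, single_mul_idem, smul_smul, ← map_mul, inv_mul_cancel,
      map_one, one_smul]
  rw [Finset.sum_congr rfl fun x _ => this x, Finset.sum_const, Finset.card_univ,
    ← Nat.card_eq_fintype_card, ← Nat.cast_smul_eq_nsmul ℂ, smul_smul,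
    inv_mul_cancel₀ card_ne_zero', one_smul]

section Trace

variable {V : Type*} [AddCommGroup V] [Module ℂ V] [FiniteDimensional ℂ V]
  (ρ : Representation ℂ G V)

theorem trace_idem : LinearMap.trace ℂ V (ρ.asAlgebraHom (idem L ϑ)) =
    (Nat.card ↥L : ℂ)⁻¹ * ∑ x : ↥L, ϑ x⁻¹ * ρ.character x := by
  simp [idem, Representation.asAlgebraHom_single, Representation.character]

theorem trace_idem_eq_finrank : LinearMap.trace ℂ V (ρ.asAlgebraHom (idem L ϑ)) =
    Module.finrank ℂ (LinearMap.range (ρ.asAlgebraHom (idem L ϑ))) := by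
  have h : IsIdempotentElem (ρ.asAlgebraHom (idem L ϑ)) := by
    rw [IsIdempotentElem, ← map_mul, idem_mul_idem]
  exact (LinearMap.IsIdempotentElem.isProj_range _ h).trace

theorem innerG_indFun : innerG G (indFun L ϑ) ρ.character =
    (starRingEnd ℂ) (LinearMap.trace ℂ V (ρ.asAlgebraHom (idem L ϑ))) := by
  have h1 : ∀ g, indFun L ϑ g * (starRingEnd ℂ) (ρ.character g) =
      (Nat.card ↥L : ℂ)⁻¹ * ∑ x : G, (if h : x * g * x⁻¹ ∈ L then ϑ ⟨x * g * x⁻¹, h⟩ else 0) *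
        (starRingEnd ℂ) (ρ.character (x * g * x⁻¹)) := by
    intro g
    rw [indFun, finsum_eq_sum_of_fintype, mul_assoc, Finset.sum_mul]
    simp only [Representation.char_conj]
  rw [innerG_eq_sum, Finset.sum_congr rfl fun g _ => h1 g, ← Finset.mul_sum, Finset.sum_comm]
  have h2 : ∀ x : G, ∑ g : G, (if h : x * g * x⁻¹ ∈ L then ϑ ⟨x * g * x⁻¹, h⟩ else 0) *
        (starRingEnd ℂ) (ρ.character (x * g * x⁻¹)) =
      ∑ y : ↥L, ϑ y * (starRingEnd ℂ) (ρ.character y) := by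
    intro x
    refine (Fintype.sum_equiv (MulAut.conj x).toEquiv _
      (fun g => (if h : g ∈ L then ϑ ⟨g, h⟩ else 0) * (starRingEnd ℂ) (ρ.character g))
      fun g => rfl).trans ?_
    simp only [dite_mul, zero_mul]
    rw [Finset.sum_dite]
    simp only [Finset.sum_const_zero, add_zero]
    refine Finset.sum_bij (fun a _ => ⟨a.1, (Finset.mem_filter.1 a.2).2⟩) (by simp) ?_ ?_ ?_
    · intro a _ b _ h
      exact Subtype.ext (congrArg (fun z : ↥L => (z : G)) h)
    · intro b _
      exact ⟨⟨b.1, by simp⟩, by simp, rfl⟩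
    · intros; rfl
  rw [Finset.sum_congr rfl fun g _ => h2 g, Finset.sum_const, Finset.card_univ,
    ← Nat.card_eq_fintype_card, nsmul_eq_mul, trace_idem, map_mul, map_sum,
    mul_left_comm _ (Nat.card G : ℂ), inv_mul_cancel_left₀ card_ne_zero', map_inv₀, map_natCast]
  simp [conj_linear]

theorem innerG_indFun_pos_iff : 0 < innerG G (indFun L ϑ) ρ.character ↔
    ρ.asAlgebraHom (idem L ϑ) ≠ 0 := by
  rw [innerG_indFun, trace_idem_eq_finrank, map_natCast, Nat.cast_pos, Module.finrank_pos_iff,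
    Submodule.nontrivial_iff_ne_bot, Ne, LinearMap.range_eq_bot]

end Trace

end Idempotent

/-! ### Counting the constituents of an induced linear character -/

section Count

variable {G : Type} [Group G] [Fintype G]

theorem linearIndependent_irr : LinearIndependent ℂ (fun f : ↥(Irr G) => (f : G → ℂ)) := by
  rw [linearIndependent_iff']
  intro s c h i hi
  have h1 : ∑ f ∈ s, c f * innerG G f i = 0 := by
    have : ∀ g, ∑ f ∈ s, c f * (f : G → ℂ) g = 0 := fun g => by
      have := congrFun h g
      simpa using this
    calc ∑ f ∈ s, c f * innerG G f i = (Nat.card G : ℂ)⁻¹ *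
          ∑ g : G, (∑ f ∈ s, c f * (f : G → ℂ) g) * (starRingEnd ℂ) ((i : G → ℂ) g) := by
          simp only [innerG_eq_sum, Finset.sum_mul, Finset.mul_sum]
          rw [Finset.sum_comm]
          refine Finset.sum_congr rfl fun g _ => Finset.sum_congr rfl fun f _ => ?_
          ring
      _ = 0 := by simp [this]
  rw [Finset.sum_eq_single i (fun b _ hb => by
    rw [innerG_irr_eq_zero b.2 i.2 (fun h => hb (Subtype.ext h)), mul_zero])
    (fun h => absurd hi h), i.2.2, mul_one] at h1
  exact h1

theorem finite_irr : Finite ↥(Irr G) := linearIndependent_irr.finite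

theorem mem_center_of_commute_single {z : MonoidAlgebra ℂ G}
    (h : ∀ g : G, MonoidAlgebra.single g 1 * z = z * MonoidAlgebra.single g 1) :
    z ∈ Subalgebra.center ℂ (MonoidAlgebra ℂ G) := by
  rw [Subalgebra.mem_center_iff]
  intro b
  refine MonoidAlgebra.induction_on (motive := fun b => b * z = z * b) b (fun g => h g) ?_ ?_
  · intro x y hx hy
    rw [add_mul, mul_add, hx, hy]
  · intro r x hx
    rw [smul_mul_assoc, mul_smul_comm, hx]

theorem sum_single_mem_center (φ : G → ℂ) (hφ : ∀ g h, φ (h * g * h⁻¹) = φ g) :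
    ∑ g : G, MonoidAlgebra.single g (φ g) ∈ Subalgebra.center ℂ (MonoidAlgebra ℂ G) := by
  refine mem_center_of_commute_single fun h => ?_
  rw [Finset.mul_sum, Finset.sum_mul]
  refine Fintype.sum_equiv (MulAut.conj h).toEquiv _ _ fun g => ?_
  simp [MonoidAlgebra.single_mul_single, hφ]

/-- Evaluation of a group algebra element against the members of a set of functions. -/
def evalMap (K : Set (G → ℂ)) : MonoidAlgebra ℂ G →ₗ[ℂ] (↥K → ℂ) where
  toFun a f := ∑ g : G, a.coeff g * (f : G → ℂ) g
  map_add' a b := by ext f; simp [add_mul, Finset.sum_add_distrib]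
  map_smul' c a := by ext f; simp [Finset.mul_sum, mul_assoc]

theorem coeff_sum_single (φ : G → ℂ) (h : G) :
    (∑ g : G, MonoidAlgebra.single g (φ g)).coeff h = φ h := by
  rw [MonoidAlgebra.coeff_sum, Finsupp.finsetSum_apply, Finset.sum_eq_single h]
  · simp
  · intro b _ hb
    simp [hb]
  · simp

theorem evalMap_surjective (K : Set (G → ℂ)) (hK : K ⊆ Irr G) (c : ↥K → ℂ) :
    ∃ z ∈ Subalgebra.center ℂ (MonoidAlgebra ℂ G), evalMap K z = c := by
  have := @finite_irr G _ _
  have hfin : Finite ↥K := Set.Finite.subset (Set.toFinite (Irr G)) hK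
  have := Fintype.ofFinite ↥K
  refine ⟨∑ g : G, MonoidAlgebra.single g
    ((Nat.card G : ℂ)⁻¹ * ∑ f : ↥K, c f * (starRingEnd ℂ) ((f : G → ℂ) g)), ?_, ?_⟩
  · refine sum_single_mem_center _ fun g h => ?_
    congr 1
    refine Finset.sum_congr rfl fun f _ => ?_
    obtain ⟨V, hV⟩ := (hK f.2).1
    rw [hV, FDRep.char_conj]
  · ext f
    simp only [evalMap, LinearMap.coe_mk, AddHom.coe_mk, coeff_sum_single]
    calc _ = ∑ i : ↥K, c i * innerG G f i := by
          simp only [innerG_eq_sum, Finset.sum_mul, Finset.mul_sum]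
          rw [Finset.sum_comm]
          refine Finset.sum_congr rfl fun g _ => Finset.sum_congr rfl fun f _ => ?_
          ring
      _ = c f := by
          rw [Finset.sum_eq_single f (fun b _ hb => by
            rw [innerG_irr_eq_zero (hK f.2) (hK b.2) (fun h => hb (Subtype.ext h.symm)), mul_zero])
            (fun h => absurd (Finset.mem_univ _) h), (hK f.2).2, mul_one]

variable (L : Subgroup G) (ϑ : ↥L →* ℂ)

theorem evalMap_eq_zero_iff {z : MonoidAlgebra ℂ G}
    (hz : z ∈ Subalgebra.center ℂ (MonoidAlgebra ℂ G)) :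
    evalMap (IrrConstituents G (indFun L ϑ)) z = 0 ↔ z * idem L ϑ = 0 := by
  constructor
  · intro h
    refine eq_zero_of_forall_irreducible _ fun V _ _ _ ρ _ => ?_
    have hirr := character_mem_irr ρ
    by_cases hk : 0 < innerG G (indFun L ϑ) ρ.character
    · obtain ⟨c, hc⟩ := asAlgebraHom_center ρ
        ((innerG_character (FDRep.of ρ) (FDRep.of ρ)).symm.trans hirr.2) hz
      have h1 : evalMap (IrrConstituents G (indFun L ϑ)) z ⟨ρ.character, hirr, hk⟩ = 0 := by
        rw [h]; rfl
      have h2 := trace_asAlgebraHom ρ z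
      rw [hc] at h2
      have h3 : c * (Module.finrank ℂ V : ℂ) = 0 := by
        refine Eq.trans ?_ (h2.trans h1)
        simp
      have h4 : c = 0 := by
        rcases mul_eq_zero.1 h3 with h4 | h4
        · exact h4
        · exfalso
          have h5 := (innerG_indFun_pos_iff L ϑ ρ).1 hk
          have : Subsingleton V := Module.finrank_zero_iff.1 (Nat.cast_eq_zero.1 h4)
          exact h5 (Subsingleton.elim _ _)
      rw [map_mul, hc, h4, zero_smul, zero_mul]
    · rw [innerG_indFun_pos_iff, not_not] at hk
      rw [map_mul, hk, mul_zero]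
  · intro h
    ext ⟨f, ⟨⟨V, hV⟩, hn⟩, hk⟩
    subst hV
    obtain ⟨c, hc⟩ := asAlgebraHom_center V.ρ ((innerG_character V V).symm.trans hn) hz
    have h1 := congrArg (Representation.asAlgebraHom V.ρ) h
    rw [map_mul, hc, map_zero, smul_mul_assoc, one_mul, smul_eq_zero] at h1
    have h2 := h1.resolve_right ((innerG_indFun_pos_iff L ϑ V.ρ).1 hk)
    have h3 := trace_asAlgebraHom V.ρ z
    rw [hc, h2, zero_smul, map_zero] at h3
    exact h3.symm

theorem card_irrConstituents : Nat.card ↥(IrrConstituents G (indFun L ϑ)) =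
    Module.finrank ℂ ((Subalgebra.toSubmodule (Subalgebra.center ℂ (MonoidAlgebra ℂ G))).map
      (LinearMap.mulRight ℂ (idem L ϑ))) := by
  set Z := Subalgebra.toSubmodule (Subalgebra.center ℂ (MonoidAlgebra ℂ G))
  set K := IrrConstituents G (indFun L ϑ)
  have hK : K ⊆ Irr G := fun f hf => hf.1
  have := @finite_irr G _ _
  have hfin : Finite ↥K := Set.Finite.subset (Set.toFinite (Irr G)) hK
  have := Fintype.ofFinite ↥K
  have h1 := LinearMap.finrank_range_add_finrank_ker ((LinearMap.mulRight ℂ (idem L ϑ)).domRestrict Z)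
  have h2 := LinearMap.finrank_range_add_finrank_ker ((evalMap K).domRestrict Z)
  have h3 : LinearMap.ker ((LinearMap.mulRight ℂ (idem L ϑ)).domRestrict Z) =
      LinearMap.ker ((evalMap K).domRestrict Z) := by
    ext z
    simp only [LinearMap.mem_ker, LinearMap.domRestrict_apply, LinearMap.mulRight_apply]
    exact (evalMap_eq_zero_iff L ϑ z.2).symm
  have h4 : LinearMap.range ((evalMap K).domRestrict Z) = ⊤ := by
    rw [LinearMap.range_eq_top]
    intro c
    obtain ⟨z, hz, h⟩ := evalMap_surjective K hK c
    exact ⟨⟨z, hz⟩, h⟩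
  rw [h3] at h1
  rw [h4, finrank_top, Module.finrank_fintype_fun_eq_card] at h2
  rw [LinearMap.range_domRestrict] at h1
  rw [Nat.card_eq_fintype_card]
  omega

end Count

/-! ### The Hecke-type space of an induced linear character -/

section Hecke

variable {G : Type} [Group G] [Fintype G] (L S : Subgroup G) (ϑ : ↥L →* ℂ)

/-- Elements of the group algebra supported on `S`, transforming under right translation by `L`
through the inverse of `ϑ`, and invariant under conjugation by `S`. -/
def heckeSpace : Submodule ℂ (MonoidAlgebra ℂ G) where
  carrier := {a | (∀ g, g ∉ S → a.coeff g = 0) ∧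
    (∀ (y : ↥L) (g : G), a.coeff g = ϑ y * a.coeff (g * y)) ∧
    ∀ s ∈ S, ∀ g : G, a.coeff (s * g * s⁻¹) = a.coeff g}
  zero_mem' := by simp
  add_mem' := by
    rintro a b ⟨ha1, ha2, ha3⟩ ⟨hb1, hb2, hb3⟩
    refine ⟨fun g hg => ?_, fun y g => ?_, fun s hs g => ?_⟩
    · simp [ha1 g hg, hb1 g hg]
    · simp only [MonoidAlgebra.coeff_add, Finsupp.add_apply, mul_add]
      rw [← ha2, ← hb2]
    · simp [ha3 s hs, hb3 s hs]
  smul_mem' := by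
    rintro c a ⟨ha1, ha2, ha3⟩
    refine ⟨fun g hg => ?_, fun y g => ?_, fun s hs g => ?_⟩
    · simp [ha1 g hg]
    · simp only [MonoidAlgebra.coeff_smul, Finsupp.smul_apply, smul_eq_mul]
      rw [mul_left_comm, ← ha2]
    · simp [ha3 s hs]

theorem linear_inv_mul (y : ↥L) : ϑ y⁻¹ * ϑ y = 1 := by
  rw [← map_mul, inv_mul_cancel, map_one]

theorem mul_idem_of_forall {w : MonoidAlgebra ℂ G}
    (hw : ∀ y : ↥L, w * MonoidAlgebra.single (y : G) 1 = ϑ y • w) : w * idem L ϑ = w := by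
  rw [idem, mul_smul_comm, Finset.mul_sum]
  have : ∀ x : ↥L, w * MonoidAlgebra.single (x : G) (ϑ x⁻¹) = w := fun x => by
    rw [single_eq_smul, mul_smul_comm, hw, smul_smul, linear_inv_mul, one_smul]
  rw [Finset.sum_congr rfl fun x _ => this x, Finset.sum_const, Finset.card_univ,
    ← Nat.card_eq_fintype_card, ← Nat.cast_smul_eq_nsmul ℂ, smul_smul,
    inv_mul_cancel₀ card_ne_zero', one_smul]

theorem idem_mul_of_forall {w : MonoidAlgebra ℂ G}
    (hw : ∀ y : ↥L, MonoidAlgebra.single (y : G) 1 * w = ϑ y • w) : idem L ϑ * w = w := by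
  rw [idem, smul_mul_assoc, Finset.sum_mul]
  have : ∀ x : ↥L, MonoidAlgebra.single (x : G) (ϑ x⁻¹) * w = w := fun x => by
    rw [single_eq_smul, smul_mul_assoc, hw, smul_smul, linear_inv_mul, one_smul]
  rw [Finset.sum_congr rfl fun x _ => this x, Finset.sum_const, Finset.card_univ,
    ← Nat.card_eq_fintype_card, ← Nat.cast_smul_eq_nsmul ℂ, smul_smul,
    inv_mul_cancel₀ card_ne_zero', one_smul]

theorem single_mul_single_one (g h : G) :
    MonoidAlgebra.single g (1 : ℂ) * MonoidAlgebra.single h 1 = MonoidAlgebra.single (g * h) 1 := by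
  rw [MonoidAlgebra.single_mul_single, one_mul]

variable {L S ϑ}

theorem single_mul_idem_comm (hnorm : ∀ s ∈ S, ∀ y : ↥L, ∃ y' : ↥L, s * y = y' * s ∧ ϑ y' = ϑ y)
    {s : G} (hs : s ∈ S) :
    MonoidAlgebra.single s 1 * idem L ϑ = idem L ϑ * MonoidAlgebra.single s 1 := by
  have h1 : idem L ϑ * MonoidAlgebra.single s 1 * idem L ϑ = idem L ϑ * MonoidAlgebra.single s 1 := by
    refine mul_idem_of_forall L ϑ fun y => ?_
    obtain ⟨y', h, h'⟩ := hnorm s hs y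
    rw [mul_assoc, single_mul_single_one, h, ← single_mul_single_one, ← mul_assoc,
      idem_mul_single, h', smul_mul_assoc]
  have h2 : idem L ϑ * (MonoidAlgebra.single s 1 * idem L ϑ) =
      MonoidAlgebra.single s 1 * idem L ϑ := by
    refine idem_mul_of_forall L ϑ fun y => ?_
    obtain ⟨y', h, h'⟩ := hnorm s⁻¹ (S.inv_mem hs) y
    have h3 : (y : G) * s = s * y' := by
      have := congrArg (fun t => s * t * s) h
      simpa [mul_assoc] using this
    rw [← mul_assoc, single_mul_single_one, h3, ← single_mul_single_one, mul_assoc,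
      single_mul_idem, h', mul_smul_comm]
  rw [← h1, mul_assoc, h2]

theorem idem_mul_single_mul_idem
    (hsep : ∀ g, g ∉ S → ∃ y y' : ↥L, y * g = g * y' ∧ ϑ y ≠ ϑ y') {g : G} (hg : g ∉ S) :
    idem L ϑ * MonoidAlgebra.single g 1 * idem L ϑ = 0 := by
  obtain ⟨y, y', h, h'⟩ := hsep g hg
  have h1 : idem L ϑ * MonoidAlgebra.single (y * g) 1 * idem L ϑ =
      ϑ y • (idem L ϑ * MonoidAlgebra.single g 1 * idem L ϑ) := by
    rw [← single_mul_single_one, ← mul_assoc, idem_mul_single, smul_mul_assoc, smul_mul_assoc]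
  have h2 : idem L ϑ * MonoidAlgebra.single (y * g) 1 * idem L ϑ =
      ϑ y' • (idem L ϑ * MonoidAlgebra.single g 1 * idem L ϑ) := by
    rw [h, ← single_mul_single_one, mul_assoc, mul_assoc, single_mul_idem, mul_smul_comm,
      mul_smul_comm, mul_assoc]
  rw [h1, ← sub_eq_zero, ← sub_smul, smul_eq_zero] at h2
  exact h2.resolve_left (sub_ne_zero.2 h')

theorem center_map_idem (hnorm : ∀ s ∈ S, ∀ y : ↥L, ∃ y' : ↥L, s * y = y' * s ∧ ϑ y' = ϑ y)
    (hsep : ∀ g, g ∉ S → ∃ y y' : ↥L, y * g = g * y' ∧ ϑ y ≠ ϑ y') :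
    (Subalgebra.toSubmodule (Subalgebra.center ℂ (MonoidAlgebra ℂ G))).map
      (LinearMap.mulRight ℂ (idem L ϑ)) = heckeSpace L S ϑ := by
  apply le_antisymm
  · rintro _ ⟨z, hz, rfl⟩
    have hz' : ∀ b, b * z = z * b := (Subalgebra.mem_center_iff (R := ℂ)).1 hz
    rw [LinearMap.mulRight_apply]
    set a := z * idem L ϑ with ha
    have hr : ∀ y : ↥L, a * MonoidAlgebra.single (y : G) 1 = ϑ y • a := fun y => by
      rw [ha, mul_assoc, idem_mul_single, mul_smul_comm]
    have hl : ∀ y : ↥L, MonoidAlgebra.single (y : G) 1 * a = ϑ y • a := fun y => by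
      rw [ha, ← mul_assoc, hz', mul_assoc, single_mul_idem, mul_smul_comm]
    have hr' : ∀ (y : ↥L) (g : G), a.coeff g = ϑ y * a.coeff (g * y) := fun y g => by
      have := congrArg (fun b => b.coeff (g * y)) (hr y)
      simpa [MonoidAlgebra.coeff_mul_single_apply] using this
    have hl' : ∀ (y : ↥L) (g : G), a.coeff g = ϑ y * a.coeff (y * g) := fun y g => by
      have := congrArg (fun b => b.coeff (y * g)) (hl y)
      simpa [MonoidAlgebra.coeff_single_mul_apply] using this
    refine ⟨fun g hg => ?_, hr', fun s hs g => ?_⟩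
    · obtain ⟨y, y', h, h'⟩ := hsep g hg
      by_contra h0
      have h1 := hr' y' g
      have h2 := hl' y g
      rw [h] at h2
      have h3 : a.coeff (g * y') ≠ 0 := fun h4 => h0 (by rw [h2, h4, mul_zero])
      exact h' (mul_right_cancel₀ h3 (h2.symm.trans h1))
    · have h1 : MonoidAlgebra.single s 1 * a = a * MonoidAlgebra.single s 1 := by
        rw [ha, ← mul_assoc, hz', mul_assoc, single_mul_idem_comm hnorm hs, mul_assoc]
      have := congrArg (fun b => b.coeff (s * g)) h1
      simpa [MonoidAlgebra.coeff_single_mul_apply, MonoidAlgebra.coeff_mul_single_apply]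
        using this.symm
  · rintro w ⟨hw1, hw2, hw3⟩
    have hr : w * idem L ϑ = w := by
      refine mul_idem_of_forall L ϑ fun y => ?_
      ext g
      have := hw2 y (g * (y : G)⁻¹)
      simpa [MonoidAlgebra.coeff_mul_single_apply] using this
    have hc : ∀ s ∈ S, MonoidAlgebra.single s 1 * w * MonoidAlgebra.single s⁻¹ 1 = w := by
      intro s hs
      ext g
      have := hw3 s⁻¹ (S.inv_mem hs) g
      simpa [MonoidAlgebra.coeff_mul_single_apply, MonoidAlgebra.coeff_single_mul_apply, mul_assoc]
        using this
    have hcard : (Nat.card ↥S : ℂ) ≠ 0 := card_ne_zero'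
    refine ⟨(Nat.card ↥S : ℂ)⁻¹ •
      ∑ g : G, MonoidAlgebra.single g 1 * w * MonoidAlgebra.single g⁻¹ 1, ?_, ?_⟩
    · refine Submodule.smul_mem _ _ (mem_center_of_commute_single fun h => ?_)
      rw [Finset.mul_sum, Finset.sum_mul]
      refine Fintype.sum_equiv (Equiv.mulLeft h) _ _ fun g => ?_
      simp only [Equiv.coe_mulLeft, mul_inv_rev, ← single_mul_single_one, mul_assoc]
      simp [← MonoidAlgebra.one_def]
    · rw [LinearMap.mulRight_apply, smul_mul_assoc, Finset.sum_mul, inv_smul_eq_iff₀ hcard]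
      have h1 : ∀ g : G, MonoidAlgebra.single g 1 * w * MonoidAlgebra.single g⁻¹ 1 * idem L ϑ =
          if g ∈ S then w else 0 := by
        intro g
        split_ifs with hg
        · rw [hc g hg, hr]
        · rw [← hr]
          have := idem_mul_single_mul_idem hsep (fun h => hg (inv_mem_iff.1 h) : g⁻¹ ∉ S)
          simp only [mul_assoc] at this ⊢
          rw [this, mul_zero, mul_zero]
      rw [Finset.sum_congr rfl fun g _ => h1 g, ← Finset.sum_filter, Finset.sum_const,
        ← Nat.cast_smul_eq_nsmul ℂ]
      congr 2
      rw [Nat.card_eq_fintype_card, Fintype.card_subtype]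

/-- Transport of the Hecke space along a parametrization of `S`. -/
theorem finrank_heckeSpace {X : Type} [Fintype X] (ι : X → G) (hι : Function.Injective ι)
    (hS : ∀ g, g ∈ S ↔ ∃ x, ι x = g) (hLS : L ≤ S) (W : Submodule ℂ (X → ℂ))
    (hW : ∀ f, f ∈ W ↔ (∀ (y : ↥L) (x x' : X), ι x' = ι x * y → f x = ϑ y * f x') ∧
      ∀ s x x' : X, ι x' = ι s * ι x * (ι s)⁻¹ → f x' = f x) :
    Module.finrank ℂ (heckeSpace L S ϑ) = Module.finrank ℂ W := by
  let T : (X → ℂ) →ₗ[ℂ] MonoidAlgebra ℂ G :=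
    { toFun f := ∑ x, MonoidAlgebra.single (ι x) (f x)
      map_add' f h := by simp [Finset.sum_add_distrib]
      map_smul' c f := by simp [Finset.smul_sum] }
  have hT : ∀ f x, (T f).coeff (ι x) = f x := by
    intro f x
    simp only [T, LinearMap.coe_mk, AddHom.coe_mk]
    rw [MonoidAlgebra.coeff_sum, Finsupp.finsetSum_apply, Finset.sum_eq_single x]
    · simp
    · intro b _ hb
      simp [hι.ne hb]
    · simp
  have hT0 : ∀ f g, g ∉ S → (T f).coeff g = 0 := by
    intro f g hg
    simp only [T, LinearMap.coe_mk, AddHom.coe_mk]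
    rw [MonoidAlgebra.coeff_sum, Finsupp.finsetSum_apply]
    refine Finset.sum_eq_zero fun x _ => ?_
    have : ι x ≠ g := fun h => hg ((hS g).2 ⟨x, h⟩)
    simp [this]
  have hinj : Function.Injective T := fun f h hfh => by
    ext x
    rw [← hT f, ← hT h, hfh]
  have hmap : W.map T = heckeSpace L S ϑ := by
    ext a
    constructor
    · rintro ⟨f, hf, rfl⟩
      obtain ⟨h1, h2⟩ := (hW f).1 hf
      refine ⟨hT0 f, fun y g => ?_, fun s hs g => ?_⟩
      · by_cases hg : g ∈ S
        · obtain ⟨x, rfl⟩ := (hS g).1 hg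
          obtain ⟨x', hx'⟩ := (hS _).1 (S.mul_mem hg (hLS y.2))
          rw [← hx', hT, hT]
          exact h1 y x x' hx'
        · rw [hT0 f g hg, hT0 f _ fun h => hg ((S.mul_mem_cancel_right (hLS y.2)).1 h), mul_zero]
      · by_cases hg : g ∈ S
        · obtain ⟨x, rfl⟩ := (hS g).1 hg
          obtain ⟨t, rfl⟩ := (hS s).1 hs
          obtain ⟨x', hx'⟩ := (hS _).1 (S.mul_mem (S.mul_mem hs hg) (S.inv_mem hs))
          rw [← hx', hT, hT]
          exact h2 t x x' hx'
        · rw [hT0 f g hg, hT0]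
          rwa [S.mul_mem_cancel_right (S.inv_mem hs), S.mul_mem_cancel_left hs]
    · rintro ⟨h0, h1, h2⟩
      refine ⟨fun x => a.coeff (ι x), (hW _).2 ⟨fun y x x' h => ?_, fun s x x' h => ?_⟩, ?_⟩
      · rw [h]; exact h1 y _
      · rw [h]; exact h2 _ ((hS _).2 ⟨s, rfl⟩) _
      · ext g
        by_cases hg : g ∈ S
        · obtain ⟨x, rfl⟩ := (hS g).1 hg
          rw [hT]
        · rw [hT0 _ g hg, h0 g hg]
  rw [← hmap]
  exact (Submodule.equivMapOfInjective T hinj W).finrank_eq.symm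

end Hecke

/-! ### Fourier analysis on a finite vector space -/

section Fourier

variable {F : Type} [Field F] [Fintype F]

theorem addChar_eq_zero {θ : AddChar F ℂ} (hθ : θ ≠ 1) {V : Type} [AddCommGroup V] [Module F V]
    (Q : Submodule F V) (φ : V →ₗ[F] F) (h : ∀ y ∈ Q, θ (φ y) = 1) {y : V} (hy : y ∈ Q) :
    φ y = 0 := by
  by_contra h0
  refine hθ ?_
  ext t
  have := h ((t / φ y) • y) (Q.smul_mem _ hy)
  rwa [map_smul, smul_eq_mul, div_mul_cancel₀ _ h0] at this

variable {V : Type} [AddCommGroup V] [Module F V] [Fintype V]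

theorem linearIndependent_dual {θ : AddChar F ℂ} (hθ : θ ≠ 1) :
    LinearIndependent ℂ (fun (ν : V →ₗ[F] F) (x : V) => θ (-(ν x))) := by
  let χ : (V →ₗ[F] F) → AddChar V ℂ := fun ν => θ.compAddMonoidHom (-ν).toAddMonoidHom
  have hχ : Function.Injective χ := by
    intro ν ν' h
    ext y
    have h1 : ∀ y ∈ (⊤ : Submodule F V), θ ((ν - ν') y) = 1 := by
      intro y _
      have h2 : θ (-(ν y)) = θ (-(ν' y)) := congrArg (fun c : AddChar V ℂ => c y) h
      have h3 : θ (-(ν y)) ≠ 0 := (θ.val_isUnit _).ne_zero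
      have h4 : θ ((ν - ν') y) * θ (-(ν y)) = θ (-(ν' y)) := by
        rw [← AddChar.map_add_eq_mul]
        congr 1
        simp only [LinearMap.sub_apply]
        ring
      rw [← h2] at h4
      exact mul_right_cancel₀ h3 (h4.trans (one_mul _).symm)
    exact sub_eq_zero.1 (addChar_eq_zero hθ ⊤ (ν - ν') h1 (y := y) trivial)
  exact (AddChar.linearIndependent V ℂ).comp χ hχ

theorem card_dual : Nat.card (V →ₗ[F] F) = Nat.card V := by
  have : Module.Finite F V := Module.Finite.of_finite
  rw [Module.natCard_eq_pow_finrank (K := F), Module.natCard_eq_pow_finrank (K := F) (V := V)]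
  congr 1
  exact Subspace.dual_finrank_eq

theorem finrank_fourier {θ : AddChar F ℂ} (hθ : θ ≠ 1) (Q : Submodule F V) (μ : V →ₗ[F] F)
    {Γ : Type} (A : Γ → V →ₗ[F] V) (hA : ∀ g, Function.Surjective (A g))
    (orb : (V →ₗ[F] F) → Set (V →ₗ[F] F))
    (horb : ∀ ν ν', orb ν = orb ν' ↔ ∃ g, ν' = ν.comp (A g))
    (hO : ∀ g (ν : V →ₗ[F] F), (∀ y ∈ Q, ν y = μ y) → ∀ y ∈ Q, ν (A g y) = μ y)
    (W : Submodule ℂ (V → ℂ))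
    (hW : ∀ f, f ∈ W ↔ (∀ x, ∀ y ∈ Q, f x = θ (μ y) * f (x + y)) ∧ ∀ g x, f (A g x) = f x) :
    Module.finrank ℂ W = Nat.card ↥{C | ∃ ν : V →ₗ[F] F, (∀ y ∈ Q, ν y = μ y) ∧ C = orb ν} := by
  have : Finite (V →ₗ[F] F) := DFunLike.finite _
  have := Fintype.ofFinite (V →ₗ[F] F)
  set O : Set (V →ₗ[F] F) := {ν | ∀ y ∈ Q, ν y = μ y} with hOdef
  set Or : Set (Set (V →ₗ[F] F)) :=
    {C | ∃ ν : V →ₗ[F] F, (∀ y ∈ Q, ν y = μ y) ∧ C = orb ν} with hOr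
  have hfin : Finite ↥Or := Set.Finite.subset (Set.finite_range orb)
    (by rintro _ ⟨ν, -, rfl⟩; exact ⟨ν, rfl⟩)
  have := Fintype.ofFinite ↥Or
  let e : (V →ₗ[F] F) → V → ℂ := fun ν x => θ (-(ν x))
  have hli : LinearIndependent ℂ e := linearIndependent_dual hθ
  have huniq : ∀ c c' : (V →ₗ[F] F) → ℂ,
      (∀ x, ∑ ν, c ν * e ν x = ∑ ν, c' ν * e ν x) → c = c' := by
    intro c c' h
    ext ν
    refine sub_eq_zero.1 (Fintype.linearIndependent_iff.1 hli (fun ν => c ν - c' ν) ?_ ν)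
    ext x
    simp [sub_mul, h]
  have hspan : ∀ f : V → ℂ, ∃ c : (V →ₗ[F] F) → ℂ, ∀ x, f x = ∑ ν, c ν * e ν x := by
    intro f
    have hcard : Fintype.card (V →ₗ[F] F) = Module.finrank ℂ (V → ℂ) := by
      rw [Module.finrank_fintype_fun_eq_card, ← Nat.card_eq_fintype_card,
        ← Nat.card_eq_fintype_card, card_dual]
    have : Nonempty (V →ₗ[F] F) := ⟨0⟩
    let b := basisOfLinearIndependentOfCardEqFinrank hli hcard
    refine ⟨b.repr f, fun x => ?_⟩
    have := congrFun (b.sum_repr f) x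
    rw [← this]
    simp [b]
  have hadd : ∀ ν x y, e ν (x + y) = θ (-(ν y)) * e ν x := by
    intro ν x y
    simp only [e]
    rw [← AddChar.map_add_eq_mul, map_add, neg_add_rev]
  have hcomp : ∀ g ν, orb ν = orb (ν.comp (A g)) := fun g ν => (horb _ _).2 ⟨g, rfl⟩
  have hOA : ∀ g ν, ν.comp (A g) ∈ O ↔ ν ∈ O := by
    intro g ν
    refine ⟨fun h => ?_, fun h => hO g ν h⟩
    obtain ⟨g', hg'⟩ := (horb _ _).1 (hcomp g ν).symm
    rw [hg']
    exact hO g' _ h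
  have hσ : ∀ g, Function.Bijective (fun ν : V →ₗ[F] F => ν.comp (A g)) := by
    intro g
    rw [← Finite.injective_iff_bijective]
    intro ν ν' h
    ext x
    obtain ⟨x, rfl⟩ := hA g x
    exact congrArg (fun φ : V →ₗ[F] F => φ x) h
  have heA : ∀ g (c : (V →ₗ[F] F) → ℂ) x,
      ∑ ν, c (ν.comp (A g)) * e ν (A g x) = ∑ ν, c ν * e ν x := by
    intro g c x
    exact Fintype.sum_equiv (Equiv.ofBijective _ (hσ g)) _ _ fun ν => rfl
  let coef : (↥Or → ℂ) → (V →ₗ[F] F) → ℂ := fun d ν => if h : ν ∈ O then d ⟨orb ν, ν, h, rfl⟩ else 0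
  have hpos : ∀ d ν (h : ν ∈ O), coef d ν = d ⟨orb ν, ν, h, rfl⟩ := fun d ν h => dif_pos h
  have hneg : ∀ d ν, ν ∉ O → coef d ν = 0 := fun d ν h => dif_neg h
  have hcoefA : ∀ d g ν, coef d (ν.comp (A g)) = coef d ν := by
    intro d g ν
    by_cases h : ν ∈ O
    · rw [hpos _ _ h, hpos _ _ ((hOA g ν).2 h)]
      congr 1
      exact Subtype.ext (hcomp g ν).symm
    · rw [hneg _ _ h, hneg _ _ (fun h' => h ((hOA g ν).1 h'))]
  let T : (↥Or → ℂ) →ₗ[ℂ] (V → ℂ) :=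
    { toFun d x := ∑ ν, coef d ν * e ν x
      map_add' d d' := by
        ext x
        simp only [Pi.add_apply, ← Finset.sum_add_distrib, ← add_mul]
        refine Finset.sum_congr rfl fun ν _ => ?_
        congr 1
        simp only [coef]
        split_ifs <;> simp
      map_smul' r d := by
        ext x
        simp only [Pi.smul_apply, smul_eq_mul, Finset.mul_sum, ← mul_assoc, RingHom.id_apply]
        refine Finset.sum_congr rfl fun ν _ => ?_
        congr 1
        simp only [coef]
        split_ifs <;> simp }
  have hTinj : Function.Injective T := by
    intro d d' h
    have h1 := huniq _ _ (fun x => congrFun h x)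
    ext ⟨C, ν, hν, hC⟩
    subst hC
    have := congrFun h1 ν
    simp only [coef] at this
    rwa [dif_pos (show ν ∈ O from hν), dif_pos (show ν ∈ O from hν)] at this
  have hrange : LinearMap.range T = W := by
    ext f
    constructor
    · rintro ⟨d, rfl⟩
      refine (hW _).2 ⟨fun x y hy => ?_, fun g x => ?_⟩
      · change ∑ ν, coef d ν * e ν x = θ (μ y) * ∑ ν, coef d ν * e ν (x + y)
        rw [Finset.mul_sum]
        refine Finset.sum_congr rfl fun ν _ => ?_
        by_cases h : ν ∈ O
        · rw [hadd, h y hy, mul_left_comm, ← mul_assoc (θ (μ y)), ← AddChar.map_add_eq_mul,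
            add_neg_cancel, AddChar.map_zero_eq_one, one_mul]
        · simp [hneg _ _ h]
      · change ∑ ν, coef d ν * e ν (A g x) = ∑ ν, coef d ν * e ν x
        rw [← heA g (coef d) x]
        simp only [hcoefA]
    · intro hf
      obtain ⟨h1, h2⟩ := (hW f).1 hf
      obtain ⟨c, hc⟩ := hspan f
      have hc1 : ∀ ν, c ν ≠ 0 → ν ∈ O := by
        intro ν hν y hy
        refine (sub_eq_zero.1 (addChar_eq_zero hθ Q (μ - ν) (fun y hy => ?_) hy)).symm
        have h3 := huniq c (fun ν => θ ((μ - ν) y) * c ν) (fun x => by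
          rw [← hc, h1 x y hy, hc, Finset.mul_sum]
          refine Finset.sum_congr rfl fun ν _ => ?_
          rw [hadd, LinearMap.sub_apply, sub_eq_add_neg, AddChar.map_add_eq_mul]
          ring)
        have h4 := congrFun h3 ν
        exact mul_right_cancel₀ hν (h4.symm.trans (one_mul _).symm)
      have hc2 : ∀ g ν, c (ν.comp (A g)) = c ν := by
        intro g ν
        have h3 : (fun ν => c (ν.comp (A g))) = c := by
          refine huniq _ _ fun x => ?_
          obtain ⟨x, rfl⟩ := hA g x
          rw [heA, ← hc, ← hc, h2]
        exact congrFun h3 ν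
      obtain ⟨d, hdC⟩ : ∃ d : ↥Or → ℂ, ∀ C : ↥Or, d C = c C.2.choose := ⟨_, fun _ => rfl⟩
      have hd : coef d = c := by
        ext ν
        by_cases h : ν ∈ O
        · rw [hpos _ _ h, hdC]
          have hex : ∃ ν' : V →ₗ[F] F, (∀ y ∈ Q, ν' y = μ y) ∧ orb ν = orb ν' := ⟨ν, h, rfl⟩
          obtain ⟨g, hg⟩ := (horb _ _).1 hex.choose_spec.2
          change c hex.choose = c ν
          rw [hg, hc2]
        · rw [hneg _ _ h]
          by_contra h0
          exact h (hc1 ν (Ne.symm h0))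
      refine ⟨d, ?_⟩
      ext x
      rw [hc]
      change ∑ ν, coef d ν * e ν x = _
      rw [hd]
  rw [← hrange, LinearMap.finrank_range_of_inj hTinj, Module.finrank_fintype_fun_eq_card,
    Nat.card_eq_fintype_card]

end Fourier

/-! ### Algebra groups of nilpotent subalgebras -/

section LinearAlgebra

variable {F : Type} [Field F] [Fintype F] {R : Type} [Ring R] [Algebra F R] [Fintype R]

theorem mem_algGroup_of_sub_one_mem {s : NonUnitalSubalgebra F R} {u : Rˣ}
    (h : (u : R) - 1 ∈ s) : u ∈ algGroup F R s := by
  have hpow : ∀ n : ℕ, ((u ^ n : Rˣ) : R) - 1 ∈ s := by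
    intro n
    induction n with
    | zero => simp
    | succ n ih =>
      have : ((u ^ (n + 1) : Rˣ) : R) - 1 =
          (((u ^ n : Rˣ) : R) - 1) * ((u : R) - 1) + (((u ^ n : Rˣ) : R) - 1) + ((u : R) - 1) := by
        rw [pow_succ]; push_cast; noncomm_ring
      rw [this]
      exact add_mem (add_mem (mul_mem ih h) ih) h
  refine ⟨h, ?_⟩
  have h1 : u⁻¹ = u ^ (Fintype.card Rˣ - 1) := by
    refine inv_eq_of_mul_eq_one_right ?_
    rw [← pow_succ', Nat.sub_add_cancel Fintype.card_pos, pow_card_eq_one]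
  rw [h1]
  exact hpow _

theorem exists_unit {s : NonUnitalSubalgebra F R} (hs : IsNil s) {x : R} (hx : x ∈ s) :
    ∃ u : Rˣ, (u : R) = 1 + x ∧ u ∈ algGroup F R s := by
  obtain ⟨N, hN⟩ := hs
  have h1 : IsNilpotent x := ⟨N, by
    have := hN (List.replicate N x) (fun y hy => by rwa [List.eq_of_mem_replicate hy]) (by simp)
    rwa [List.prod_replicate] at this⟩
  obtain ⟨u, hu⟩ := h1.isUnit_one_add
  refine ⟨u, hu, mem_algGroup_of_sub_one_mem ?_⟩
  rw [hu, add_sub_cancel_left]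
  exact hx

theorem IsNil.mono {s t : NonUnitalSubalgebra F R} (hs : IsNil s) (h : t ≤ s) : IsNil t := by
  obtain ⟨N, hN⟩ := hs
  exact ⟨N, fun l hl => hN l fun x hx => h (hl x hx)⟩

theorem exists_functional {V : Type} [AddCommGroup V] [Module F V] [Finite V]
    (Q : Submodule F (Module.Dual F V)) (P : Submodule F V) (φ : Module.Dual F V)
    (h : ∀ x ∈ P, (∀ ψ ∈ Q, ψ x = 0) → φ x = 0) : ∃ ψ ∈ Q, ∀ x ∈ P, φ x = ψ x := by
  have : Module.Finite F V := Module.Finite.of_finite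
  have h1 : φ ∈ Q ⊔ P.dualAnnihilator := by
    rw [← Subspace.dualCoannihilator_dualAnnihilator_eq (W := Q ⊔ P.dualAnnihilator),
      Submodule.mem_dualAnnihilator]
    intro x hx
    rw [Submodule.mem_dualCoannihilator] at hx
    refine h x ?_ fun ψ hψ => hx ψ (Submodule.mem_sup_left hψ)
    rw [← Subspace.dualAnnihilator_dualCoannihilator_eq (W := P),
      Submodule.mem_dualCoannihilator]
    exact fun ψ hψ => hx ψ (Submodule.mem_sup_right hψ)
  obtain ⟨ψ, hψ, χ, hχ, rfl⟩ := Submodule.mem_sup.1 h1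
  refine ⟨ψ, hψ, fun x hx => ?_⟩
  rw [Submodule.mem_dualAnnihilator] at hχ
  simp [hχ x hx]

/-- The functional `x ↦ Λ(xy)`, depending linearly on `y`. -/
def mulFunctional (Λ : R →ₗ[F] F) : R →ₗ[F] R →ₗ[F] F := (LinearMap.mul F R).flip.compr₂ Λ

theorem mul_mem_of_sub_one {s l : NonUnitalSubalgebra F R} {u z : R} (hu : u - 1 ∈ s)
    (h : ∀ x ∈ s, x * z ∈ l) (hz : z ∈ l) : u * z ∈ l := by
  have : u * z = (u - 1) * z + z := by noncomm_ring
  rw [this]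
  exact add_mem (h _ hu) hz

theorem mul_mem_of_sub_one' {s l : NonUnitalSubalgebra F R} {u z : R} (hu : u - 1 ∈ s)
    (h : ∀ x ∈ s, z * x ∈ l) (hz : z ∈ l) : z * u ∈ l := by
  have : z * u = z * (u - 1) + z := by noncomm_ring
  rw [this]
  exact add_mem (h _ hu) hz

/-! ### One step of the construction of the chains -/

section Step

variable {Λ : R →ₗ[F] F} {s l t : NonUnitalSubalgebra F R} (hs : IsNil s)
  (hl : ∀ x, x ∈ l ↔ x ∈ s ∧ ∀ y ∈ s, Λ (x * y) = 0)
  (ht : ∀ x, x ∈ t ↔ x ∈ s ∧ ∀ y ∈ l, Λ (x * y) = 0)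

include hl in
theorem step_mul_mem {x y : R} (hx : x ∈ l) (hy : y ∈ s) : x * y ∈ l := by
  rw [hl] at hx ⊢
  refine ⟨mul_mem hx.1 hy, fun z hz => ?_⟩
  rw [mul_assoc]
  exact hx.2 _ (mul_mem hy hz)

include hl ht in
theorem step_mul_mem' {x y : R} (hx : x ∈ t) (hy : y ∈ l) : x * y ∈ l := by
  rw [hl]
  refine ⟨mul_mem ((ht x).1 hx).1 ((hl y).1 hy).1, fun z hz => ?_⟩
  rw [mul_assoc]
  exact ((ht x).1 hx).2 _ (step_mul_mem hl hy hz)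

include hl ht in
theorem step_le : l ≤ t := fun x hx =>
  (ht x).2 ⟨((hl x).1 hx).1, fun y hy => ((hl x).1 hx).2 y ((hl y).1 hy).1⟩

include hl in
theorem step_lam_mul {x w : R} (hx : x ∈ l) (hw : w - 1 ∈ s) : Λ (x * w) = Λ x := by
  have : x * w = x * (w - 1) + x := by noncomm_ring
  rw [this, map_add, ((hl x).1 hx).2 _ hw, zero_add]

include hl in
theorem step_mul_unit {x w : R} (hx : x ∈ l) (hw : w - 1 ∈ s) : x * w ∈ l :=
  mul_mem_of_sub_one' hw (fun _ h => step_mul_mem hl hx h) hx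

theorem mul_sub_one_mem {s : NonUnitalSubalgebra F R} {a b : R} (ha : a - 1 ∈ s)
    (hb : b - 1 ∈ s) : a * b - 1 ∈ s := by
  have : a * b - 1 = (a - 1) * (b - 1) + (a - 1) + (b - 1) := by noncomm_ring
  rw [this]
  exact add_mem (add_mem (mul_mem ha hb) ha) hb

include hs hl ht in
theorem step_separation {θ : AddChar F ℂ} (hθ : θ ≠ 1) {u : Rˣ} (hu : u ∈ algGroup F R s)
    (hut : u ∉ algGroup F R t) :
    ∃ Y ∈ l, ((u⁻¹ : Rˣ) : R) * Y * u ∈ l ∧ θ (Λ Y) ≠ θ (Λ (((u⁻¹ : Rˣ) : R) * Y * u)) := by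
  by_contra! hcon
  set v : R := ((u⁻¹ : Rˣ) : R) with hv
  let Q : Submodule F R := l.toSubmodule ⊓ l.toSubmodule.comap (LinearMap.mulLeft F v)
  have h1 : ∀ Y ∈ Q, (Λ - Λ.comp (LinearMap.mulLeft F v)) Y = 0 := by
    intro Y hY
    refine addChar_eq_zero hθ Q _ (fun Y hY => ?_) hY
    obtain ⟨hY1, hY2⟩ : Y ∈ l ∧ v * Y ∈ l := hY
    have h2 := hcon Y hY1 (step_mul_unit hl hY2 hu.1)
    rw [step_lam_mul hl hY2 hu.1] at h2
    change θ (Λ Y - Λ (v * Y)) = 1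
    rw [sub_eq_add_neg, AddChar.map_add_eq_mul, h2, ← AddChar.map_add_eq_mul, add_neg_cancel,
      AddChar.map_zero_eq_one]
  let N : Submodule F (Module.Dual F R) := s.toSubmodule.map (mulFunctional Λ) ⊔
    s.toSubmodule.map ((LinearMap.lcomp F F (LinearMap.mulLeft F v)).comp (mulFunctional Λ))
  obtain ⟨ψ, hψ, hψ'⟩ := exists_functional N s.toSubmodule
    (Λ - Λ.comp (LinearMap.mulLeft F v)) (by
    intro X hX h
    have hX' : X ∈ s := hX
    refine h1 X ⟨?_, ?_⟩
    · refine (hl X).2 ⟨hX, fun y hy => ?_⟩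
      exact h _ (Submodule.mem_sup_left ⟨y, hy, rfl⟩)
    · refine (hl _).2 ⟨mul_mem_of_sub_one hu.2 (fun x hx => mul_mem hx hX') hX, fun y hy => ?_⟩
      exact h _ (Submodule.mem_sup_right ⟨y, hy, rfl⟩))
  obtain ⟨_, ⟨y, hy, rfl⟩, _, ⟨y', hy', rfl⟩, rfl⟩ := Submodule.mem_sup.1 hψ
  replace hψ' : ∀ X ∈ s, Λ X - Λ (v * X) = Λ (X * y) + Λ (v * X * y') := hψ'
  obtain ⟨w, hw, hws⟩ := exists_unit hs (show y' ∈ s from hy')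
  refine hut ((algGroup F R t).inv_mem_iff.1 (mem_algGroup_of_sub_one_mem ?_))
  rw [ht]
  refine ⟨hu.2, fun Z hZ => ?_⟩
  have h3 := hψ' (Z * ((w⁻¹ : Rˣ) : R)) ((hl _).1 (step_mul_unit hl hZ hws.2)).1
  have h4 : v * (Z * ((w⁻¹ : Rˣ) : R)) * y' = v * Z - v * (Z * ((w⁻¹ : Rˣ) : R)) := by
    have : y' = (w : R) - 1 := by rw [hw]; abel
    rw [this, mul_sub, mul_one, mul_assoc, mul_assoc, Units.inv_mul, mul_one]
  rw [h4, map_sub, step_lam_mul hl hZ hws.2, ((hl _).1 (step_mul_unit hl hZ hws.2)).2 y hy] at h3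
  rw [← hv, sub_mul, one_mul, map_sub]
  linear_combination -h3

include hl in
theorem step_exists_right {ν : R →ₗ[F] F} (hν : ∀ x ∈ l, ν x = Λ x) :
    ∃ y ∈ s, ∀ x ∈ s, ν x = Λ (x * (1 + y)) := by
  obtain ⟨_, ⟨y, hy, rfl⟩, h⟩ := exists_functional (s.toSubmodule.map (mulFunctional Λ))
    s.toSubmodule (ν - Λ) (by
      intro x hx h
      rw [LinearMap.sub_apply, sub_eq_zero]
      exact hν x ((hl x).2 ⟨hx, fun y hy => h _ ⟨y, hy, rfl⟩⟩))
  refine ⟨y, hy, fun x hx => ?_⟩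
  have : ν x - Λ x = Λ (x * y) := h x hx
  rw [mul_add, mul_one, map_add, ← this]
  abel

include hs hl ht in
theorem step_conj_mem {ν ν' : R →ₗ[F] F} (hν : ∀ x ∈ l, ν x = Λ x) (hν' : ∀ x ∈ l, ν' x = Λ x)
    {u : Rˣ} (hu : u ∈ algGroup F R s)
    (h : ∀ x ∈ s, ν' x = ν (u * x * ((u⁻¹ : Rˣ) : R))) : u ∈ algGroup F R t := by
  obtain ⟨y, hy, hk⟩ := step_exists_right hl hν
  obtain ⟨y', hy', hk'⟩ := step_exists_right hl hν'
  obtain ⟨k, hk1, hks⟩ := exists_unit hs hy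
  have hk2 : 1 + y' - 1 ∈ s := by rwa [add_sub_cancel_left]
  refine mem_algGroup_of_sub_one_mem ((ht _).2 ⟨hu.1, fun X hX => ?_⟩)
  have hw : ((k⁻¹ : Rˣ) : R) * u - 1 ∈ s := mul_sub_one_mem hks.2 hu.1
  have hx : X * (((k⁻¹ : Rˣ) : R) * u) ∈ l := step_mul_unit hl hX hw
  have hxs := ((hl _).1 hx).1
  have h1 := h _ hxs
  have hmem : (u : R) * (X * (((k⁻¹ : Rˣ) : R) * u)) * ((u⁻¹ : Rˣ) : R) ∈ s :=
    mul_mem_of_sub_one' hu.2 (fun _ hz => mul_mem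
      (mul_mem_of_sub_one hu.1 (fun _ hz => mul_mem hz hxs) hxs) hz)
      (mul_mem_of_sub_one hu.1 (fun _ hz => mul_mem hz hxs) hxs)
  rw [hk' _ hxs, hk _ hmem, mul_assoc X, step_lam_mul hl hX (mul_sub_one_mem hw hk2), ← hk1] at h1
  have h2 : (u : R) * (X * (((k⁻¹ : Rˣ) : R) * u)) * ((u⁻¹ : Rˣ) : R) * k = u * X := by
    simp [mul_assoc]
  rw [h2] at h1
  rw [sub_mul, one_mul, map_sub, ← h1, sub_self]

include hs hl ht in
theorem step_exists_conj {ν ν' : R →ₗ[F] F} (hν : ∀ x ∈ l, ν x = Λ x)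
    (h : ∀ x ∈ t, ν' x = ν x) :
    ∃ u ∈ algGroup F R l, ∀ x ∈ s, ν' x = ν (u * x * ((u⁻¹ : Rˣ) : R)) := by
  obtain ⟨y₀, hy₀, hk⟩ := step_exists_right hl hν
  obtain ⟨k, hk1, hks⟩ := exists_unit hs hy₀
  have hls : l ≤ s := fun x hx => ((hl x).1 hx).1
  obtain ⟨_, ⟨y, hy, rfl⟩, h1⟩ := exists_functional (l.toSubmodule.map (mulFunctional ν))
    s.toSubmodule (ν' - ν) (by
      intro x hx hx0
      have hx' : x ∈ s := hx
      rw [LinearMap.sub_apply, sub_eq_zero]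
      refine h x ((ht x).2 ⟨hx, fun y hy => ?_⟩)
      have hyk : y * ((k⁻¹ : Rˣ) : R) ∈ l := step_mul_unit hl hy hks.2
      have h2 : ν (x * (y * ((k⁻¹ : Rˣ) : R))) = 0 := hx0 _ ⟨_, hyk, rfl⟩
      rw [hk _ (mul_mem hx' (hls hyk)), ← hk1, mul_assoc, mul_assoc, Units.inv_mul, mul_one] at h2
      exact h2)
  obtain ⟨w, hw, hwl⟩ := exists_unit (hs.mono hls) (show y ∈ l from hy)
  refine ⟨w⁻¹, (algGroup F R l).inv_mem hwl, fun x hx => ?_⟩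
  have h2 : ν' x - ν x = ν (x * y) := h1 x hx
  have h3 : x * (w : R) ∈ s := by
    rw [hw, mul_add, mul_one]
    exact add_mem hx (mul_mem hx (hls hy))
  have h4 : (((w⁻¹ : Rˣ) : R) - 1) * (x * w) ∈ l := step_mul_mem hl hwl.2 h3
  have h5 : ν ((((w⁻¹ : Rˣ) : R) - 1) * (x * w)) = 0 := by
    rw [hν _ h4]
    exact ((hl _).1 hwl.2).2 _ h3
  have h6 : ((w⁻¹ : Rˣ) : R) * x * (((w⁻¹)⁻¹ : Rˣ) : R) =
      (((w⁻¹ : Rˣ) : R) - 1) * (x * w) + (x + x * y) := by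
    rw [inv_inv, sub_mul, one_mul]
    nth_rewrite 3 [hw]
    noncomm_ring
  rw [h6, map_add, h5, zero_add, map_add, ← h2]
  abel

end Step

end LinearAlgebra

/-! ### The chains of subalgebras -/

section Chain

variable {F : Type} [Field F] [Fintype F] {R : Type} [Ring R] [Algebra F R] [Fintype R]

theorem exists_extension (J : NonUnitalSubalgebra F R) (lam : ↥J →ₗ[F] F) :
    ∃ Λ : R →ₗ[F] F, ∀ x : ↥J, Λ x = lam x := by
  obtain ⟨Λ, hΛ⟩ := LinearMap.exists_extend (p := J.toSubmodule) lam
  exact ⟨Λ, fun x => LinearMap.congr_fun hΛ x⟩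

theorem algGroup_mono {s t : NonUnitalSubalgebra F R} (h : s ≤ t) :
    algGroup F R s ≤ algGroup F R t := fun _ hu => ⟨h hu.1, h hu.2⟩

variable {J : NonUnitalSubalgebra F R} {lam : ↥J →ₗ[F] F}

theorem sChain_le (i : ℕ) : sChain J lam i ≤ J := (sChainAux J lam i).2

theorem sChain_succ_le (i : ℕ) : sChain J lam (i + 1) ≤ sChain J lam i := sStep_le J lam _ _

variable {Λ : R →ₗ[F] F} (hΛ : ∀ x : ↥J, Λ x = lam x)

include hΛ

theorem lamE_eq {x : R} (hx : x ∈ J) : lamE J lam x = Λ x := by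
  rw [lamE_apply J lam hx, ← hΛ]

theorem mem_lChain (i : ℕ) (x : R) : x ∈ lChain J lam i ↔
    x ∈ sChain J lam i ∧ ∀ y ∈ sChain J lam i, Λ (x * y) = 0 := by
  change (x ∈ sChain J lam i ∧ ∀ y ∈ sChain J lam i, lamE J lam (x * y) = 0) ↔ _
  refine and_congr_right fun hx => forall₂_congr fun y hy => ?_
  rw [lamE_eq hΛ (mul_mem (sChain_le i hx) (sChain_le i hy))]

theorem mem_sChain_succ (i : ℕ) (x : R) : x ∈ sChain J lam (i + 1) ↔
    x ∈ sChain J lam i ∧ ∀ y ∈ lChain J lam i, Λ (x * y) = 0 := by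
  change (x ∈ sChain J lam i ∧ ∀ y ∈ lChain J lam i, lamE J lam (x * y) = 0) ↔ _
  refine and_congr_right fun hx => forall₂_congr fun y hy => ?_
  rw [lamE_eq hΛ (mul_mem (sChain_le i hx) (sChain_le i ((mem_lChain hΛ i y).1 hy).1))]

theorem lChain_mono : Monotone (lChain J lam) := monotone_nat_of_le_succ fun i x hx =>
  (mem_lChain hΛ _ x).2 ⟨step_le (mem_lChain hΛ i) (mem_sChain_succ hΛ i) hx, fun y hy =>
    ((mem_lChain hΛ i x).1 hx).2 y (sChain_succ_le i hy)⟩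

theorem sChain_stable : sChain J lam (Fintype.card R + 1) = sbar J lam := by
  by_contra hne
  have hstep : ∀ i, sChain J lam (i + 1) = sChain J lam i →
      sChain J lam (i + 2) = sChain J lam (i + 1) := by
    intro i hi
    have hl : lChain J lam (i + 1) = lChain J lam i := by
      ext x
      rw [mem_lChain hΛ, mem_lChain hΛ, hi]
    ext x
    rw [mem_sChain_succ hΛ (i + 1), hl]
    exact and_iff_left_of_imp fun h => ((mem_sChain_succ hΛ i x).1 h).2
  have hlt : ∀ i ≤ Fintype.card R, sChain J lam (i + 1) ≠ sChain J lam i := by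
    intro i hi h
    refine hne ?_
    have : ∀ j, sChain J lam (i + j + 1) = sChain J lam (i + j) := by
      intro j
      induction j with
      | zero => exact h
      | succ j ih => exact hstep _ ih
    have h2 := this (Fintype.card R - i)
    rwa [Nat.add_sub_cancel' hi] at h2
  have hcard : ∀ i ≤ Fintype.card R + 1,
      (sChain J lam i : Set R).ncard + i ≤ Fintype.card R := by
    intro i
    induction i with
    | zero =>
      intro _
      rw [← Nat.card_eq_fintype_card, ← Set.ncard_univ]
      exact Set.ncard_le_ncard (Set.subset_univ _)
    | succ i ih =>
      intro hi
      have h1 := ih (by omega)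
      have h2 : (sChain J lam (i + 1) : Set R).ncard < (sChain J lam i : Set R).ncard :=
        Set.ncard_lt_ncard ((sChain_succ_le i).lt_of_ne (hlt i (by omega)))
      omega
  have := hcard _ le_rfl
  omega

theorem mem_lbar (x : R) : x ∈ lbar J lam ↔
    x ∈ sbar J lam ∧ ∀ y ∈ sbar J lam, Λ (x * y) = 0 := mem_lChain hΛ _ x

theorem mem_sbar (x : R) : x ∈ sbar J lam ↔
    x ∈ sbar J lam ∧ ∀ y ∈ lbar J lam, Λ (x * y) = 0 := by
  have := mem_sChain_succ hΛ (Fintype.card R) x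
  rwa [sChain_stable hΛ] at this

theorem exists_separation (hJ : IsNil J) {θ : AddChar F ℂ} (hθ : θ ≠ 1) {u : Rˣ}
    (hu : u ∈ algGroup F R J) (hus : u ∉ algGroup F R (sbar J lam)) :
    ∃ Y ∈ lbar J lam, ((u⁻¹ : Rˣ) : R) * Y * u ∈ lbar J lam ∧
      θ (Λ Y) ≠ θ (Λ (((u⁻¹ : Rˣ) : R) * Y * u)) := by
  have : ∀ i ≤ Fintype.card R, u ∉ algGroup F R (sChain J lam i) →
      ∃ Y ∈ lbar J lam, ((u⁻¹ : Rˣ) : R) * Y * u ∈ lbar J lam ∧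
        θ (Λ Y) ≠ θ (Λ (((u⁻¹ : Rˣ) : R) * Y * u)) := by
    intro i
    induction i with
    | zero => exact fun _ h => absurd hu h
    | succ i ih =>
      intro hi h
      by_cases h1 : u ∈ algGroup F R (sChain J lam i)
      · obtain ⟨Y, hY, hY', hne⟩ := step_separation (hJ.mono (sChain_le i)) (mem_lChain hΛ i)
          (mem_sChain_succ hΛ i) hθ h1 h
        have hle : lChain J lam i ≤ lbar J lam := lChain_mono hΛ (by omega : i ≤ Fintype.card R)
        exact ⟨Y, hle hY, hle hY', hne⟩
      · exact ih (by omega) h1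
  exact this _ le_rfl hus

theorem conj_iff (hJ : IsNil J) {ν ν' : R →ₗ[F] F} (hν : ∀ x ∈ lbar J lam, ν x = Λ x)
    (hν' : ∀ x ∈ lbar J lam, ν' x = Λ x) :
    (∃ u ∈ algGroup F R J, ∀ x ∈ J, ν' x = ν (u * x * ((u⁻¹ : Rˣ) : R))) ↔
      ∃ u ∈ algGroup F R (sbar J lam), ∀ x ∈ sbar J lam,
        ν' x = ν (u * x * ((u⁻¹ : Rˣ) : R)) := by
  have : ∀ i ≤ Fintype.card R,
      ((∃ u ∈ algGroup F R J, ∀ x ∈ J, ν' x = ν (u * x * ((u⁻¹ : Rˣ) : R))) ↔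
        ∃ u ∈ algGroup F R (sChain J lam i), ∀ x ∈ sChain J lam i,
          ν' x = ν (u * x * ((u⁻¹ : Rˣ) : R))) := by
    intro i
    induction i with
    | zero => exact fun _ => Iff.rfl
    | succ i ih =>
      intro hi
      rw [ih (by omega)]
      have hle : lChain J lam i ≤ lbar J lam := lChain_mono hΛ (by omega : i ≤ Fintype.card R)
      have hl := mem_lChain hΛ i
      have ht := mem_sChain_succ hΛ i
      constructor
      · rintro ⟨u, hu, h⟩
        exact ⟨u, step_conj_mem (hJ.mono (sChain_le i)) hl ht (fun x hx => hν x (hle hx))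
          (fun x hx => hν' x (hle hx)) hu h, fun x hx => h x (sChain_succ_le i hx)⟩
      · rintro ⟨u, hu, h⟩
        let ν'' : R →ₗ[F] F :=
          ν.comp ((LinearMap.mulRight F ((u⁻¹ : Rˣ) : R)).comp (LinearMap.mulLeft F (u : R)))
        obtain ⟨v, hv, hv'⟩ := step_exists_conj (ν := ν'') (ν' := ν') (hJ.mono (sChain_le i)) hl ht
          (fun x hx => (h x (step_le hl ht hx)).symm.trans (hν' x (hle hx))) h
        refine ⟨u * v, mul_mem (algGroup_mono (sChain_succ_le i) hu)
          (algGroup_mono ((step_le hl ht).trans (sChain_succ_le i)) hv), fun x hx => ?_⟩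
        rw [hv' x hx]
        change ν (u * (v * x * ((v⁻¹ : Rˣ) : R)) * ((u⁻¹ : Rˣ) : R)) = _
        rw [mul_inv_rev]
        push_cast
        simp only [mul_assoc]
  exact this _ le_rfl

end Chain

/-! ### Coadjoint orbits -/

section CoadjointOrbits

variable {F : Type} [Field F] [Fintype F] {R : Type} [Ring R] [Algebra F R] [Fintype R]
  {J : NonUnitalSubalgebra F R}

theorem coe_coAct_arg (g : ↥(algGroup F R J)) (x : ↥J) :
    (((lmulMap g).comp (rmulMap g⁻¹) x : ↥J) : R) =
      ((g : Rˣ) : R) * x * (((g : Rˣ)⁻¹ : Rˣ) : R) := (mul_assoc _ _ _).symm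

theorem coAct_coAct (g h : ↥(algGroup F R J)) (ν : ↥J →ₗ[F] F) :
    coAct g (coAct h ν) = coAct (h * g) ν := by
  ext x
  refine congrArg ν (Subtype.ext ?_)
  change (((lmulMap h).comp (rmulMap h⁻¹) ((lmulMap g).comp (rmulMap g⁻¹) x) : ↥J) : R) =
    ((lmulMap (h * g)).comp (rmulMap (h * g)⁻¹) x : ↥J)
  rw [coe_coAct_arg, coe_coAct_arg, coe_coAct_arg, Subgroup.coe_mul, mul_inv_rev]
  push_cast
  simp only [mul_assoc]

theorem coAct_one (ν : ↥J →ₗ[F] F) : coAct 1 ν = ν := by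
  ext x
  refine congrArg ν (Subtype.ext ?_)
  rw [coe_coAct_arg]
  simp

theorem coOrbit_eq_iff (ν ν' : ↥J →ₗ[F] F) :
    coOrbit J ν = coOrbit J ν' ↔ ∃ g : ↥(algGroup F R J), ν' = coAct g ν := by
  constructor
  · intro h
    have : ν' ∈ coOrbit J ν := h ▸ ⟨1, coAct_one ν'⟩
    obtain ⟨g, hg⟩ := this
    exact ⟨g, hg.symm⟩
  · rintro ⟨g, rfl⟩
    ext κ
    constructor
    · rintro ⟨h, rfl⟩
      exact ⟨g⁻¹ * h, by simp only [coAct_coAct, mul_inv_cancel_left]⟩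
    · rintro ⟨h, rfl⟩
      exact ⟨g * h, by simp only [coAct_coAct]⟩

end CoadjointOrbits

/-! ### The terminal subalgebras -/

section Terminal

variable {F : Type} [Field F] [Fintype F] {R : Type} [Ring R] [Algebra F R] [Fintype R]
  {J : NonUnitalSubalgebra F R} {lam : ↥J →ₗ[F] F} {Λ : R →ₗ[F] F}
  (hΛ : ∀ x : ↥J, Λ x = lam x)

theorem lbar_le_sbar : lbar J lam ≤ sbar J lam := lStep_le J lam _ _

include hΛ

theorem thetaFn_eq (θ : AddChar F ℂ) (g : ↥(algGroup F R J)) :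
    thetaFn θ J lam g = θ (Λ (((g : Rˣ) : R) - 1)) := by
  rw [thetaFn, ← hΛ]
  rfl

theorem sbar_unit_mul_mem {u x : R} (hu : u - 1 ∈ sbar J lam) (hx : x ∈ lbar J lam) :
    u * x ∈ lbar J lam :=
  mul_mem_of_sub_one hu (fun _ hz => step_mul_mem' (mem_lbar hΛ) (mem_sbar hΛ) hz hx) hx

theorem lam_sbar_unit_mul {u x : R} (hu : u - 1 ∈ sbar J lam) (hx : x ∈ lbar J lam) :
    Λ (u * x) = Λ x := by
  have : u * x = (u - 1) * x + x := by noncomm_ring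
  rw [this, map_add, ((mem_sbar hΛ _).1 hu).2 _ hx, zero_add]

theorem lbar_conj_mem {u : Rˣ} (hu : u ∈ algGroup F R (sbar J lam)) {x : R}
    (hx : x ∈ lbar J lam) : (u : R) * x * ((u⁻¹ : Rˣ) : R) ∈ lbar J lam :=
  step_mul_unit (mem_lbar hΛ) (sbar_unit_mul_mem hΛ hu.1 hx) hu.2

theorem lam_lbar_conj {u : Rˣ} (hu : u ∈ algGroup F R (sbar J lam)) {x : R}
    (hx : x ∈ lbar J lam) : Λ ((u : R) * x * ((u⁻¹ : Rˣ) : R)) = Λ x := by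
  rw [step_lam_mul (mem_lbar hΛ) (sbar_unit_mul_mem hΛ hu.1 hx) hu.2, lam_sbar_unit_mul hΛ hu.1 hx]

theorem thetaFn_mul (θ : AddChar F ℂ) (x y : ↥(Lbarg J lam)) :
    thetaFn θ J lam (x * y : ↥(Lbarg J lam)) = thetaFn θ J lam x * thetaFn θ J lam y := by
  have hx : (((x : ↥(algGroup F R J)) : Rˣ) : R) - 1 ∈ lbar J lam := x.2.1
  have hy : (((y : ↥(algGroup F R J)) : Rˣ) : R) - 1 ∈ lbar J lam := y.2.1
  rw [thetaFn_eq hΛ, thetaFn_eq hΛ, thetaFn_eq hΛ, ← AddChar.map_add_eq_mul, ← map_add]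
  congr 1
  push_cast
  generalize (((x : ↥(algGroup F R J)) : Rˣ) : R) = a at *
  generalize (((y : ↥(algGroup F R J)) : Rˣ) : R) = b at *
  have : a * b - 1 = (a - 1) * (b - 1) + ((a - 1) + (b - 1)) := by noncomm_ring
  rw [this, map_add, ((mem_lbar hΛ _).1 hx).2 _ (lbar_le_sbar hy), zero_add]

omit hΛ in
/-- The linear character `θ_λ` of `L̄_λ`. -/
def lbarChar (θ : AddChar F ℂ) (J : NonUnitalSubalgebra F R) (lam : ↥J →ₗ[F] F) :
    ↥(Lbarg J lam) →* ℂ where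
  toFun x := thetaFn θ J lam x
  map_one' := by
    obtain ⟨Λ, hΛ⟩ := exists_extension J lam
    rw [thetaFn_eq hΛ]
    simp
  map_mul' := thetaFn_mul (exists_extension J lam).choose_spec θ

theorem lbarChar_apply (θ : AddChar F ℂ) (x : ↥(Lbarg J lam)) :
    lbarChar θ J lam x = θ (Λ ((((x : ↥(algGroup F R J)) : Rˣ) : R) - 1)) := thetaFn_eq hΛ θ _

theorem mem_rightOrbit_iff (hJ : IsNil J) (ν : ↥(sbar J lam) →ₗ[F] F) :
    ν ∈ rightOrbit (sbar J lam) (resTo (sbar_le J lam) lam) ↔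
      ∀ x : ↥(sbar J lam), (x : R) ∈ lbar J lam → ν x = Λ x := by
  constructor
  · rintro ⟨g, rfl⟩ x hx
    refine Eq.trans ?_ (step_lam_mul (mem_lbar hΛ) hx g.2.2)
    exact (hΛ ⟨_, sbar_le J lam (rmulMap g⁻¹ x).2⟩).symm
  · intro h
    obtain ⟨N, hN⟩ := exists_extension _ ν
    obtain ⟨y, hy, hy'⟩ := step_exists_right (mem_lbar hΛ) (ν := N) fun x hx => by
      rw [← h ⟨x, lbar_le_sbar hx⟩ hx, ← hN]
    obtain ⟨u, hu, hus⟩ := exists_unit (hJ.mono (sbar_le J lam)) hy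
    refine ⟨⟨u⁻¹, inv_mem hus⟩, ?_⟩
    ext x
    rw [← hN, hy' x x.2, ← hu]
    refine (hΛ ⟨_, sbar_le J lam (rmulMap (⟨u⁻¹, inv_mem hus⟩⁻¹) x).2⟩).symm.trans ?_
    change Λ (x * (((u⁻¹)⁻¹ : Rˣ) : R)) = _
    rw [inv_inv]

theorem center_map_idem_lbarChar (hJ : IsNil J) {θ : AddChar F ℂ} (hθ : θ ≠ 1) :
    (Subalgebra.toSubmodule (Subalgebra.center ℂ (MonoidAlgebra ℂ ↥(algGroup F R J)))).map
      (LinearMap.mulRight ℂ (idem (Lbarg J lam) (lbarChar θ J lam))) =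
      heckeSpace (Lbarg J lam) (Sbarg J lam) (lbarChar θ J lam) := by
  apply center_map_idem
  · intro s hs y
    have hs' : (s : Rˣ) ∈ algGroup F R (sbar J lam) := hs
    have hy : (((y : ↥(algGroup F R J)) : Rˣ) : R) - 1 ∈ lbar J lam := y.2.1
    have h1 : (((s * y * s⁻¹ : ↥(algGroup F R J)) : Rˣ) : R) - 1 =
        ((s : Rˣ) : R) * ((((y : ↥(algGroup F R J)) : Rˣ) : R) - 1) *
          (((s : Rˣ)⁻¹ : Rˣ) : R) := by
      rw [mul_sub, sub_mul, mul_one, Units.mul_inv]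
      push_cast
      rfl
    refine ⟨⟨s * y * s⁻¹, Subgroup.mem_subgroupOf.2 (mem_algGroup_of_sub_one_mem ?_)⟩, ?_, ?_⟩
    · rw [h1]
      exact lbar_conj_mem hΛ hs' hy
    · simp
    · rw [lbarChar_apply hΛ, lbarChar_apply hΛ, h1, lam_lbar_conj hΛ hs' hy]
  · intro g hg
    obtain ⟨Y, hY, hY', hne⟩ := exists_separation hΛ hJ hθ g.2 hg
    obtain ⟨u, hu, hul⟩ := exists_unit (hJ.mono (lbar_le J lam)) hY
    have h1 : (((g : Rˣ)⁻¹ * u * g : Rˣ) : R) - 1 = (((g : Rˣ)⁻¹ : Rˣ) : R) * Y * (g : Rˣ) := by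
      push_cast
      rw [hu, mul_add, mul_one, add_mul, Units.inv_mul, add_sub_cancel_left]
    have hmem := mem_algGroup_of_sub_one_mem (h1 ▸ hY')
    refine ⟨⟨⟨u, algGroup_mono (lbar_le J lam) hul⟩, Subgroup.mem_subgroupOf.2 hul⟩,
      ⟨⟨_, algGroup_mono (lbar_le J lam) hmem⟩, Subgroup.mem_subgroupOf.2 hmem⟩, ?_, ?_⟩
    · refine Subtype.ext ?_
      change u * (g : Rˣ) = g * ((g : Rˣ)⁻¹ * u * g)
      group
    · rw [lbarChar_apply hΛ, lbarChar_apply hΛ]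
      change θ (Λ ((u : R) - 1)) ≠ θ (Λ ((((g : Rˣ)⁻¹ * u * g : Rˣ) : R) - 1))
      rwa [h1, hu, add_sub_cancel_left]

end Terminal

/-! ### Counting constituents by coadjoint orbits -/

section Main

variable {F : Type} [Field F] [Fintype F] {R : Type} [Ring R] [Algebra F R] [Fintype R]
  {J : NonUnitalSubalgebra F R} {lam : ↥J →ₗ[F] F} {Λ : R →ₗ[F] F}
  (hΛ : ∀ x : ↥J, Λ x = lam x)

include hΛ

theorem finrank_heckeSpace_lbarChar (hJ : IsNil J) {θ : AddChar F ℂ} (hθ : θ ≠ 1) :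
    Module.finrank ℂ (heckeSpace (Lbarg J lam) (Sbarg J lam) (lbarChar θ J lam)) =
      Nat.card ↥{C : Set (↥(sbar J lam) →ₗ[F] F) |
        ∃ ν ∈ rightOrbit (sbar J lam) (resTo (sbar_le J lam) lam),
          C = coOrbit (sbar J lam) ν} := by
  have := Fintype.ofFinite ↥(sbar J lam)
  have hunit : ∀ x : ↥(sbar J lam), ∃ g : ↥(algGroup F R J),
      ((g : Rˣ) : R) = 1 + x ∧ (g : Rˣ) ∈ algGroup F R (sbar J lam) := by
    intro x
    obtain ⟨u, hu, hus⟩ := exists_unit (hJ.mono (sbar_le J lam)) x.2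
    exact ⟨⟨u, algGroup_mono (sbar_le J lam) hus⟩, hu, hus⟩
  choose ι hι hιs using hunit
  have hext : ∀ g h : ↥(algGroup F R J), ((g : Rˣ) : R) = ((h : Rˣ) : R) → g = h :=
    fun g h hgh => Subtype.ext (Units.ext hgh)
  let Q : Submodule F ↥(sbar J lam) :=
    (lbar J lam).toSubmodule.comap
      ((sbar J lam).toSubmodule.subtype : ↥(sbar J lam) →ₗ[F] R)
  have hmemQ : ∀ x : ↥(sbar J lam), x ∈ Q ↔ (x : R) ∈ lbar J lam := fun x => Iff.rfl
  set μ : ↥(sbar J lam) →ₗ[F] F := resTo (sbar_le J lam) lam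
  have hμ : ∀ x : ↥(sbar J lam), μ x = Λ x := fun x => (hΛ (inclMap (sbar_le J lam) x)).symm
  set A : ↥(algGroup F R (sbar J lam)) → ↥(sbar J lam) →ₗ[F] ↥(sbar J lam) :=
    fun g => (lmulMap g).comp (rmulMap g⁻¹)
  have hAcoe : ∀ g x, ((A g x : ↥(sbar J lam)) : R) =
      ((g : Rˣ) : R) * x * (((g : Rˣ)⁻¹ : Rˣ) : R) := fun g x => coe_coAct_arg g x
  let W : Submodule ℂ (↥(sbar J lam) → ℂ) :=
    { carrier := {f | (∀ x, ∀ y ∈ Q, f x = θ (μ y) * f (x + y)) ∧ ∀ g x, f (A g x) = f x}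
      zero_mem' := by simp
      add_mem' := by
        rintro f h ⟨hf, hf'⟩ ⟨hh, hh'⟩
        refine ⟨fun x y hy => ?_, fun g x => ?_⟩
        · rw [Pi.add_apply, Pi.add_apply, hf x y hy, hh x y hy, mul_add]
        · rw [Pi.add_apply, Pi.add_apply, hf', hh']
      smul_mem' := by
        rintro c f ⟨hf, hf'⟩
        refine ⟨fun x y hy => ?_, fun g x => ?_⟩
        · rw [Pi.smul_apply, Pi.smul_apply, hf x y hy, smul_eq_mul, smul_eq_mul, mul_left_comm]
        · rw [Pi.smul_apply, Pi.smul_apply, hf'] }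
  have hW : ∀ f, f ∈ W ↔ (∀ x, ∀ y ∈ Q, f x = θ (μ y) * f (x + y)) ∧ ∀ g x, f (A g x) = f x :=
    fun f => Iff.rfl
  have horbits : {C : Set (↥(sbar J lam) →ₗ[F] F) |
        ∃ ν ∈ rightOrbit (sbar J lam) μ, C = coOrbit (sbar J lam) ν} =
      {C | ∃ ν : ↥(sbar J lam) →ₗ[F] F, (∀ y ∈ Q, ν y = μ y) ∧ C = coOrbit (sbar J lam) ν} := by
    ext C
    refine exists_congr fun ν => and_congr_left fun _ => ?_
    rw [mem_rightOrbit_iff hΛ hJ]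
    simp only [hmemQ, hμ]
  rw [horbits, ← finrank_fourier hθ Q μ A ?_ (coOrbit (sbar J lam)) coOrbit_eq_iff ?_ W hW]
  · refine finrank_heckeSpace ι (fun x x' h => ?_) (fun g => ⟨fun hg => ?_, ?_⟩)
      (fun g hg => algGroup_mono lbar_le_sbar hg) W fun f => ?_
    · have h1 := hι x
      rw [h, hι] at h1
      exact Subtype.ext (add_left_cancel h1).symm
    · refine ⟨⟨((g : Rˣ) : R) - 1, hg.1⟩, hext _ _ ?_⟩
      rw [hι, add_sub_cancel]
    · rintro ⟨x, rfl⟩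
      exact hιs x
    rw [hW]
    refine and_congr ⟨fun h y x x' hxx => ?_, fun h x y hy => ?_⟩
      ⟨fun h s x x' hxx => ?_, fun h g x => ?_⟩
    · have hy : (((y : ↥(algGroup F R J)) : Rˣ) : R) - 1 ∈ lbar J lam := y.2.1
      have h1 : (1 : R) + x' = (1 + x) * (((y : ↥(algGroup F R J)) : Rˣ) : R) := by
        rw [← hι, ← hι, hxx]
        rfl
      have h2 : ((x' - x : ↥(sbar J lam)) : R) =
          ((ι x : Rˣ) : R) * ((((y : ↥(algGroup F R J)) : Rˣ) : R) - 1) := by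
        have : ((x' - x : ↥(sbar J lam)) : R) = (1 + (x' : R)) - (1 + x) := by
          rw [add_sub_add_left_eq_sub]
          rfl
        rw [this, h1, hι, mul_sub, mul_one]
      have h3 : x' - x ∈ Q := by
        rw [hmemQ, h2]
        exact sbar_unit_mul_mem hΛ (hιs x).1 hy
      rw [h x _ h3, add_sub_cancel, hμ, h2, lam_sbar_unit_mul hΛ (hιs x).1 hy, lbarChar_apply hΛ]
    · have h1 : ((((ι x)⁻¹ * ι (x + y) : ↥(algGroup F R J)) : Rˣ) : R) - 1 =
          (((ι x : Rˣ)⁻¹ : Rˣ) : R) * y := by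
        have : ((ι (x + y) : Rˣ) : R) = (ι x : Rˣ) + y := by
          rw [hι, hι, add_assoc]
          rfl
        push_cast
        rw [this, mul_add]
        simp
      have h2 := sbar_unit_mul_mem hΛ (hιs x).2 ((hmemQ y).1 hy)
      have h3 := h ⟨(ι x)⁻¹ * ι (x + y),
        Subgroup.mem_subgroupOf.2 (mem_algGroup_of_sub_one_mem (h1 ▸ h2))⟩ x (x + y) (by simp)
      rw [h3, lbarChar_apply hΛ, h1, lam_sbar_unit_mul hΛ (hιs x).2 ((hmemQ y).1 hy), hμ]
    · have h1 : x' = A ⟨ι s, hιs s⟩ x := by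
        have h2 : (1 : R) + x' = (ι s : Rˣ) * (1 + x) * (((ι s : Rˣ)⁻¹ : Rˣ) : R) := by
          rw [← hι, ← hι, hxx]
          push_cast
          rfl
        refine Subtype.ext (add_left_cancel (a := (1 : R)) ?_)
        rw [h2, hAcoe, mul_add, mul_one, add_mul, Units.mul_inv]
      rw [h1, h]
    · refine h ⟨((g : Rˣ) : R) - 1, g.2.1⟩ x _ (hext _ _ ?_)
      have h1 : ι ⟨((g : Rˣ) : R) - 1, g.2.1⟩ = ⟨g, algGroup_mono (sbar_le J lam) g.2⟩ := by
        refine hext _ _ ?_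
        rw [hι, add_sub_cancel]
      rw [h1, hι, hAcoe]
      push_cast
      rw [hι, mul_add, mul_one, add_mul]
      simp
  · intro g x
    refine ⟨A g⁻¹ x, Subtype.ext ?_⟩
    rw [hAcoe, hAcoe]
    simp [mul_assoc]
  · intro g ν hν y hy
    have hy' : A g y ∈ Q := by
      rw [hmemQ, hAcoe]
      exact lbar_conj_mem hΛ g.2 hy
    rw [hν _ hy', hμ, hμ, hAcoe, lam_lbar_conj hΛ g.2 ((hmemQ y).1 hy)]

omit hΛ in
theorem card_irrConstituents_xi (hJ : IsNil J) {θ : AddChar F ℂ} (hθ : θ ≠ 1)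
    (lam : ↥J →ₗ[F] F) :
    Nat.card ↥(IrrConstituents ↥(algGroup F R J) (xi θ J lam)) =
      Nat.card ↥{C : Set (↥(sbar J lam) →ₗ[F] F) |
        ∃ ν ∈ rightOrbit (sbar J lam) (resTo (sbar_le J lam) lam),
          C = coOrbit (sbar J lam) ν} := by
  obtain ⟨Λ, hΛ⟩ := exists_extension J lam
  refine (card_irrConstituents (Lbarg J lam) (lbarChar θ J lam)).trans ?_
  rw [center_map_idem_lbarChar hΛ hJ hθ]
  exact finrank_heckeSpace_lbarChar hΛ hJ hθ

omit hΛ in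
theorem card_range_eq {α β γ : Type} {f : α → β} {g : α → γ}
    (h : ∀ a b, f a = f b ↔ g a = g b) :
    Nat.card ↥(Set.range f) = Nat.card ↥(Set.range g) := by
  have hker : Setoid.ker f = Setoid.ker g := Setoid.ext h
  rw [← Nat.card_congr (Setoid.quotientKerEquivRange f), hker]
  exact Nat.card_congr (Setoid.quotientKerEquivRange g)

theorem coOrbit_eq_iff_resTo (hJ : IsNil J) {ν ν' : ↥J →ₗ[F] F}
    (hν : ∀ x : ↥J, (x : R) ∈ lbar J lam → ν x = Λ x)
    (hν' : ∀ x : ↥J, (x : R) ∈ lbar J lam → ν' x = Λ x) :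
    coOrbit J ν = coOrbit J ν' ↔ coOrbit (sbar J lam) (resTo (sbar_le J lam) ν) =
      coOrbit (sbar J lam) (resTo (sbar_le J lam) ν') := by
  obtain ⟨N, hN⟩ := exists_extension J ν
  obtain ⟨N', hN'⟩ := exists_extension J ν'
  have key : ∀ (s : NonUnitalSubalgebra F R) (hs : s ≤ J),
      (∃ g : ↥(algGroup F R s), resTo hs ν' = coAct g (resTo hs ν)) ↔
        ∃ u ∈ algGroup F R s, ∀ x ∈ s, N' x = N (u * x * ((u⁻¹ : Rˣ) : R)) := by
    intro s hs
    have h1 : ∀ x : ↥s, resTo hs ν' x = N' x := fun x => (hN' (inclMap hs x)).symm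
    have h2 : ∀ (g : ↥(algGroup F R s)) (x : ↥s), coAct g (resTo hs ν) x =
        N ((g : Rˣ) * x * (((g : Rˣ)⁻¹ : Rˣ) : R)) := fun g x => by
      rw [← coe_coAct_arg]
      exact (hN (inclMap hs _)).symm
    constructor
    · rintro ⟨g, hg⟩
      refine ⟨g, g.2, fun x hx => ?_⟩
      rw [← h2 g ⟨x, hx⟩, ← hg]
      exact (h1 ⟨x, hx⟩).symm
    · rintro ⟨u, hu, h⟩
      refine ⟨⟨u, hu⟩, LinearMap.ext fun x => ?_⟩
      rw [h1, h2, h x x.2]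
  rw [coOrbit_eq_iff, coOrbit_eq_iff, key]
  refine (key J le_rfl).trans (conj_iff hΛ hJ (fun x hx => ?_) fun x hx => ?_)
  · rw [← hν ⟨x, lbar_le J lam hx⟩ hx, ← hN]
  · rw [← hν' ⟨x, lbar_le J lam hx⟩ hx, ← hN']

omit hΛ in
theorem card_coOrbit_Xi (hJ : IsNil J) (lam : ↥J →ₗ[F] F) :
    Nat.card ↥{C : Set (↥J →ₗ[F] F) | ∃ ν ∈ Xi J lam, C = coOrbit J ν} =
      Nat.card ↥{C : Set (↥(sbar J lam) →ₗ[F] F) |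
        ∃ ν ∈ rightOrbit (sbar J lam) (resTo (sbar_le J lam) lam),
          C = coOrbit (sbar J lam) ν} := by
  obtain ⟨Λ, hΛ⟩ := exists_extension J lam
  let O : Set (↥J →ₗ[F] F) := {ν | ∀ x : ↥J, (x : R) ∈ lbar J lam → ν x = Λ x}
  have hs : ∀ s ∈ Sbarg J lam, rightAct s lam ∈ O := by
    intro s hs x hx
    refine Eq.trans ?_ (step_lam_mul (mem_lbar hΛ) hx hs.2)
    exact (hΛ (rmulMap s⁻¹ x)).symm
  have hres : ∀ ν ∈ O, resTo (sbar_le J lam) ν ∈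
      rightOrbit (sbar J lam) (resTo (sbar_le J lam) lam) := fun ν hν =>
    (mem_rightOrbit_iff hΛ hJ _).2 fun x hx => hν (inclMap (sbar_le J lam) x) hx
  have h1 : {C : Set (↥J →ₗ[F] F) | ∃ ν ∈ Xi J lam, C = coOrbit J ν} =
      Set.range fun ν : ↥O => coOrbit J (ν : ↥J →ₗ[F] F) := by
    ext C
    constructor
    · rintro ⟨_, ⟨g, s, hsS, rfl⟩, rfl⟩
      exact ⟨⟨_, hs s hsS⟩, (coOrbit_eq_iff _ _).2 ⟨g, rfl⟩⟩
    · rintro ⟨⟨ν, hν⟩, rfl⟩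
      obtain ⟨g, hg⟩ := hres ν hν
      let g' : ↥(algGroup F R J) := ⟨g, algGroup_mono (sbar_le J lam) g.2⟩
      have hg' : g' ∈ Sbarg J lam := g.2
      refine ⟨rightAct g' lam, ⟨1, g', hg', (coAct_one _).symm⟩, ?_⟩
      refine (coOrbit_eq_iff_resTo hΛ hJ hν (hs g' hg')).2 ?_
      rw [← hg]
      rfl
  have h2 : {C : Set (↥(sbar J lam) →ₗ[F] F) |
        ∃ ν ∈ rightOrbit (sbar J lam) (resTo (sbar_le J lam) lam),
          C = coOrbit (sbar J lam) ν} =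
      Set.range fun ν : ↥O => coOrbit (sbar J lam) (resTo (sbar_le J lam) (ν : ↥J →ₗ[F] F)) := by
    ext C
    constructor
    · rintro ⟨ν, hν, rfl⟩
      obtain ⟨N, hN⟩ := exists_extension _ ν
      refine ⟨⟨N.comp J.toSubmodule.subtype, fun x hx => ?_⟩, ?_⟩
      · rw [← (mem_rightOrbit_iff hΛ hJ ν).1 hν ⟨x, lbar_le_sbar hx⟩ hx, ← hN]
        rfl
      · exact congrArg _ (LinearMap.ext hN)
    · rintro ⟨ν, rfl⟩
      exact ⟨_, hres ν ν.2, rfl⟩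
  rw [h1, h2]
  exact card_range_eq fun ν ν' => coOrbit_eq_iff_resTo hΛ hJ ν.2 ν'.2

end Main

theorem statement13 (F : Type) [Field F] [Fintype F]
    (R : Type) [Ring R] [Algebra F R] [Fintype R]
    (J : NonUnitalSubalgebra F R) (hJ : IsNil J)
    (θ : AddChar F ℂ) (hθ : θ ≠ 1)
    (lam : ↥J →ₗ[F] F) :
    Nat.card ↥(IrrConstituents ↥(algGroup F R J) (xi θ J lam)) =
      Nat.card ↥{C : Set (↥J →ₗ[F] F) | ∃ ν ∈ Xi J lam, C = coOrbit J ν} ∧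
    Nat.card ↥(IrrConstituents ↥(algGroup F R J) (xi θ J lam)) =
      Nat.card ↥{C : Set (↥(sbar J lam) →ₗ[F] F) |
        ∃ ν ∈ rightOrbit (sbar J lam) (resTo (sbar_le J lam) lam),
          C = coOrbit (sbar J lam) ν} := by
  exact ⟨(card_irrConstituents_xi hJ hθ lam).trans (card_coOrbit_Xi hJ lam).symm,
    card_irrConstituents_xi hJ hθ lam⟩

end IterChar
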